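/- arXiv:1806.00477 — 2 statements merged into one kernel-verified Lean document; each statement's English description precedes it below -/
import Mathlib

section
/- Let a < b, x ∈ (a,b], and let u : (1,2) × [a,b] → ℝ be jointly continuous with jointly continuous partial derivative ∂u/∂σ. Fix σ₀ ∈ (1,2) and set I(σ,y) = ∫_a^y (y−s)^{1−σ} u(σ,s) ds. Assume I has partial derivatives ∂²I/∂x² and ∂I/∂σ in a neighborhood of (σ₀,x), that all relevant mixed partial derivatives of I of order three exist at (σ₀,x) and commute (so that ∂/∂σ and d²/dx² may be interchanged), and that the maps y ↦ ∫_a^y (y−s)^{1−σ₀}·(∂u/∂σ)(σ₀,s) ds and y ↦ ∫_a^y log(y−s)·(y−s)^{1−σ₀}·u(σ₀,s) ds are twice differentiable at y = x. Then the map σ ↦ (1/Γ(2−σ))·(∂²I/∂x²)(σ,x) is differentiable at σ₀ with derivative (1/Γ(2−σ₀)) · d²/dx² ∫_a^x (x−s)^{1−σ₀}·(∂u/∂σ)(σ₀,s) ds + A₂(σ₀) · (1/Γ(2−σ₀))·(∂²I/∂x²)(σ₀,x) − (1/Γ(2−σ₀)) · d²/dx² ∫_a^x log(x−s)·(x−s)^{1−σ₀}·u(σ₀,s)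 ds, where A₂(σ) := Γ(2−σ) · (d/dσ)(1/Γ(2−σ)). -/
open MeasureTheory Set Filter Topology
open scoped Convolution

lemma integral_indicator_mul_sub_eq {a b y : ℝ} (hy : y ∈ Icc a b) (k f : ℝ → ℝ)
    (hf : ∀ s ≤ a, f s = 0) :
    ∫ t, (Ioc 0 (b - a)).indicator k t * f (y - t) = ∫ s in a..y, k (y - s) * f s := by
  rw [← integral_sub_left_eq_self _ volume y, intervalIntegral.integral_of_le hy.1,
    integral_Ioc_eq_integral_Ioo, ← integral_indicator measurableSet_Ioo]
  congr 1 with s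
  rw [sub_sub_cancel]
  by_cases hs : s ∈ Ioo a y
  · have h' : y - s ∈ Ioc 0 (b - a) := ⟨by linarith [hs.2], by linarith [hs.1, hy.2]⟩
    rw [indicator_of_mem hs, indicator_of_mem h']
  · rw [indicator_of_notMem hs]
    rcases le_or_gt s a with h | h
    · rw [hf s h, mul_zero]
    · rw [indicator_of_notMem, zero_mul]
      exact fun h' => hs ⟨h, by linarith [h'.1]⟩

section Volterra

variable {a b : ℝ} {k k₁ k₂ v : ℝ → ℝ}

lemma integral_indicator_mul_indicator_sub_eq {y : ℝ} (hy : y ∈ Icc a b) (k v : ℝ → ℝ) :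
    ∫ t, (Ioc 0 (b - a)).indicator k t * (Ioc a b).indicator v (y - t) =
      ∫ s in a..y, k (y - s) * v s := by
  rw [integral_indicator_mul_sub_eq hy k ((Ioc a b).indicator v) fun s hs =>
    indicator_of_notMem (fun h => not_lt.2 hs h.1) v]
  refine intervalIntegral.integral_congr_ae (ae_of_all _ fun s hs => ?_)
  rw [uIoc_of_le hy.1] at hs
  rw [indicator_of_mem (show s ∈ Ioc a b from ⟨hs.1, hs.2.trans hy.2⟩)]

lemma exists_bound_indicator (hv : ContinuousOn v (Icc a b)) :
    ∃ C, ∀ s, ‖(Ioc a b).indicator v s‖ ≤ C := by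
  obtain ⟨C, hC⟩ := isCompact_Icc.exists_bound_of_continuousOn hv
  refine ⟨max C 0, fun s => ?_⟩
  by_cases hs : s ∈ Ioc a b
  · rw [indicator_of_mem hs]
    exact (hC s (Ioc_subset_Icc_self hs)).trans (le_max_left _ _)
  · simp [indicator_of_notMem hs]

lemma integrable_indicator_Ioc (hv : ContinuousOn v (Icc a b)) :
    Integrable ((Ioc a b).indicator v) :=
  (integrable_indicator_iff measurableSet_Ioc).2
    ((hv.integrableOn_Icc).mono_set Ioc_subset_Icc_self)

lemma intervalIntegrable_volterra (hab : a ≤ b) (hk : IntegrableOn k (Ioc 0 (b - a)))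
    (hv : ContinuousOn v (Icc a b)) :
    IntervalIntegrable (fun y => ∫ s in a..y, k (y - s) * v s) volume a b := by
  have h := ((integrable_indicator_iff measurableSet_Ioc).2 hk).integrable_convolution
    (ContinuousLinearMap.mul ℝ ℝ) (integrable_indicator_Ioc hv)
  rw [intervalIntegrable_iff_integrableOn_Icc_of_le hab]
  refine (h.integrableOn (s := Icc a b)).congr_fun (fun y hy => ?_) measurableSet_Icc
  exact integral_indicator_mul_indicator_sub_eq hy k v

lemma continuousAt_volterra (hk : IntegrableOn k (Ioc 0 (b - a)))
    (hv : ContinuousOn v (Icc a b)) {y : ℝ} (hy : y ∈ Ioo a b) :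
    ContinuousAt (fun y => ∫ s in a..y, k (y - s) * v s) y := by
  have hK := (integrable_indicator_iff measurableSet_Ioc).2 hk
  obtain ⟨C, hC⟩ := exists_bound_indicator hv
  have key : ContinuousAt
      (fun y => ∫ t, (Ioc 0 (b - a)).indicator k t * (Ioc a b).indicator v (y - t)) y := by
    refine continuousAt_of_dominated
      (bound := fun t => ‖(Ioc 0 (b - a)).indicator k t‖ * C)
      (Eventually.of_forall fun z => hK.aestronglyMeasurable.mul
        ((integrable_indicator_Ioc hv).comp_sub_left z).aestronglyMeasurable)
      (Eventually.of_forall fun z => ae_of_all _ fun t => ?_) (hK.norm.mul_const C) ?_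
    · rw [norm_mul]
      exact mul_le_mul_of_nonneg_left (hC _) (norm_nonneg _)
    · have hne : ∀ᵐ t : ℝ, t ≠ y - a := by simp [ae_iff, measure_singleton]
      filter_upwards [hne] with t ht
      by_cases h0 : 0 < t
      · refine continuousAt_const.mul (ContinuousAt.comp (f := fun z => z - t)
          (g := (Ioc a b).indicator v) ?_ (by fun_prop))
        rcases lt_or_gt_of_ne ht with h | h
        · have hmem : y - t ∈ Ioo a b := ⟨by linarith, by linarith [hy.2]⟩
          have hnhds := Ioo_mem_nhds hmem.1 hmem.2
          refine (hv.continuousAt (mem_of_superset hnhds Ioo_subset_Icc_self)).congr ?_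
          filter_upwards [hnhds] with z hz
          rw [indicator_of_mem (Ioo_subset_Ioc_self hz)]
        · refine (continuousAt_const (y := (0 : ℝ))).congr ?_
          filter_upwards [Iio_mem_nhds (show y - t < a by linarith)] with z hz
          rw [indicator_of_notMem fun h' => lt_asymm hz h'.1]
      · rw [indicator_of_notMem fun h => h0 h.1]
        simpa using continuousAt_const
  refine key.congr ?_
  filter_upwards [Icc_mem_nhds hy.1 hy.2] with z hz
  exact integral_indicator_mul_indicator_sub_eq hz k v

lemma integral_volterra_volterra (hk₁ : IntegrableOn k₁ (Ioc 0 (b - a)))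
    (hk₂ : IntegrableOn k₂ (Ioc 0 (b - a))) (hv : ContinuousOn v (Icc a b)) {y : ℝ}
    (hy : y ∈ Icc a b) :
    ∫ s in a..y, k₁ (y - s) * ∫ r in a..s, k₂ (s - r) * v r =
      ∫ s in a..y, (∫ t in 0..(y - s), k₁ (y - s - t) * k₂ t) * v s := by
  set K₁ := (Ioc 0 (b - a)).indicator k₁ with hK₁def
  set K₂ := (Ioc 0 (b - a)).indicator k₂ with hK₂def
  set f := (Ioc a b).indicator v with hfdef
  have hK₁ : Integrable K₁ := (integrable_indicator_iff measurableSet_Ioc).2 hk₁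
  have hK₂ : Integrable K₂ := (integrable_indicator_iff measurableSet_Ioc).2 hk₂
  have hf := integrable_indicator_Ioc hv
  have hf0 : ∀ s ≤ a, f s = 0 := fun s hs => indicator_of_notMem (fun h => not_lt.2 hs h.1) v
  obtain ⟨C, hC⟩ := exists_bound_indicator hv
  let L := ContinuousLinearMap.mul ℝ ℝ
  have hexists (g : ℝ → ℝ) (hg : Integrable g) (x : ℝ) :
      ConvolutionExistsAt (fun x => ‖g x‖) (fun x => ‖f x‖) x L volume := by
    refine hg.norm.mul_bdd (c := C) (hf.norm.comp_sub_left x).aestronglyMeasurable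
      (ae_of_all _ fun t => ?_)
    simpa using hC (x - t)
  have hassoc : ((K₁ ⋆[L] K₂) ⋆[L] f) y = (K₁ ⋆[L] (K₂ ⋆[L] f)) y := by
    refine convolution_assoc L L L L (fun x y z => mul_assoc x y z) hK₁.aestronglyMeasurable
      hK₂.aestronglyMeasurable hf.aestronglyMeasurable
      (hK₁.ae_convolution_exists L hK₂) (ae_of_all _ (hexists K₂ hK₂)) ?_
    refine hK₁.norm.mul_bdd (c := (∫ t, ‖K₂ t‖) * C)
      ((hK₂.norm.integrable_convolution L hf.norm).comp_sub_left y).aestronglyMeasurable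
      (ae_of_all _ fun t => ?_)
    rw [convolution_def, ← integral_mul_const]
    refine norm_integral_le_of_norm_le (hK₂.norm.mul_const C) (ae_of_all _ fun s => ?_)
    simp only [ContinuousLinearMap.mul_apply', norm_mul, norm_norm]
    exact mul_le_mul_of_nonneg_left (hC _) (norm_nonneg _)
  have hinner {s : ℝ} (hs : s ∈ Icc a b) :
      (K₂ ⋆[L] f) s = ∫ r in a..s, k₂ (s - r) * v r :=
    integral_indicator_mul_indicator_sub_eq hs k₂ v
  have hright : (K₁ ⋆[L] (K₂ ⋆[L] f)) y =
      ∫ s in a..y, k₁ (y - s) * ∫ r in a..s, k₂ (s - r) * v r := by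
    refine (integral_indicator_mul_sub_eq hy k₁ (K₂ ⋆[L] f) fun s hs => ?_).trans ?_
    · refine integral_eq_zero_of_ae (ae_of_all _ fun t => ?_)
      simp only [L, ContinuousLinearMap.mul_apply', Pi.zero_apply]
      by_cases ht : t ∈ Ioc 0 (b - a)
      · rw [hf0 _ (by linarith [ht.1]), mul_zero]
      · rw [hK₂def, indicator_of_notMem ht, zero_mul]
    · refine intervalIntegral.integral_congr fun s hs => ?_
      rw [uIcc_of_le hy.1] at hs
      simp only [hinner ⟨hs.1, hs.2.trans hy.2⟩]
  have hK₂0 : ∀ t ≤ 0, K₂ t = 0 := fun t ht => indicator_of_notMem (fun h => not_lt.2 ht h.1) _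
  have hkernel {t : ℝ} (ht : t ∈ Icc 0 (b - a)) :
      (K₁ ⋆[L] K₂) t = ∫ r in 0..t, k₁ (t - r) * k₂ r := by
    have := integral_indicator_mul_indicator_sub_eq ht k₁ k₂
    rwa [sub_zero] at this
  have hleft : ((K₁ ⋆[L] K₂) ⋆[L] f) y =
      ∫ s in a..y, (∫ t in 0..(y - s), k₁ (y - s - t) * k₂ t) * v s := by
    have h1 : ((K₁ ⋆[L] K₂) ⋆[L] f) y =
        ∫ t, (Ioc 0 (b - a)).indicator (K₁ ⋆[L] K₂) t * f (y - t) := by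
      rw [convolution_def]
      congr 1 with t
      simp only [L, ContinuousLinearMap.mul_apply']
      by_cases ht : t ∈ Ioc 0 (b - a)
      · rw [indicator_of_mem ht]
      · rw [indicator_of_notMem ht, zero_mul]
        rcases le_or_gt t 0 with h | h
        · refine mul_eq_zero_of_left (integral_eq_zero_of_ae (ae_of_all _ fun r => ?_)) _
          simp only [ContinuousLinearMap.mul_apply', Pi.zero_apply]
          by_cases hr : r ∈ Ioc 0 (b - a)
          · rw [hK₂0 _ (by linarith [hr.1]), mul_zero]
          · rw [hK₁def, indicator_of_notMem hr, zero_mul]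
        · rw [hf0, mul_zero]
          have := not_le.1 fun h' => ht ⟨h, h'⟩
          linarith [hy.2]
    rw [h1, integral_indicator_mul_indicator_sub_eq hy]
    refine intervalIntegral.integral_congr fun s hs => ?_
    rw [uIcc_of_le hy.1] at hs
    simp only [hkernel (t := y - s) ⟨by linarith [hs.2], by linarith [hs.1, hy.2]⟩]
  rw [← hright, ← hleft, hassoc]

end Volterra

lemma abs_log_le_rpow_add_rpow {t ε : ℝ} (ht : 0 < t) (hε : 0 < ε) :
    |Real.log t| ≤ (t ^ ε + t ^ (-ε)) / ε := by
  have h1 := Real.log_le_rpow_div ht.le hε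
  have h2 := Real.log_le_rpow_div (inv_nonneg.2 ht.le) hε
  rw [Real.log_inv, Real.inv_rpow ht.le, ← Real.rpow_neg ht.le] at h2
  have h3 : 0 ≤ t ^ ε / ε := by positivity
  have h4 : 0 ≤ t ^ (-ε) / ε := by positivity
  rw [add_div, abs_le]
  constructor <;> linarith

lemma intervalIntegrable_log_mul_rpow {r R : ℝ} (hr : -1 < r) (hR : 0 ≤ R) :
    IntervalIntegrable (fun t => Real.log t * t ^ r) volume 0 R := by
  obtain ⟨ε, hε, hε'⟩ : ∃ ε > 0, -1 < r - ε := ⟨(r + 1) / 2, by linarith, by linarith⟩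
  have hg : IntervalIntegrable (fun t : ℝ => (t ^ (r + ε) + t ^ (r - ε)) / ε) volume 0 R :=
    ((intervalIntegral.intervalIntegrable_rpow' (by linarith)).add
      (intervalIntegral.intervalIntegrable_rpow' hε')).div_const ε
  refine hg.mono_fun' (by fun_prop) ?_
  filter_upwards [ae_restrict_mem measurableSet_uIoc] with t ht
  rw [uIoc_of_le hR] at ht
  have h := mul_le_mul_of_nonneg_right (abs_log_le_rpow_add_rpow ht.1 hε)
    (Real.rpow_nonneg ht.1.le r)
  rw [norm_mul, Real.norm_eq_abs, Real.norm_of_nonneg (Real.rpow_nonneg ht.1.le r)]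
  refine h.trans_eq ?_
  rw [sub_eq_add_neg, Real.rpow_add ht.1, Real.rpow_add ht.1]
  ring

lemma intervalIntegrable_log_one_sub_mul_rpow {r : ℝ} (hr : -1 < r) :
    IntervalIntegrable (fun t => Real.log (1 - t) * t ^ r) volume 0 1 := by
  refine IntervalIntegrable.trans (b := 1 / 2) ?_ ?_
  · refine (intervalIntegral.intervalIntegrable_rpow' hr).continuousOn_mul ?_
    rw [uIcc_of_le (by norm_num)]
    exact fun t ht => ((Real.continuousAt_log (by linarith [ht.2])).comp
      (f := fun t : ℝ => 1 - t) (by fun_prop)).continuousWithinAt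
  · refine IntervalIntegrable.mul_continuousOn ?_ ?_
    · have := (intervalIntegral.intervalIntegrable_log' (a := 1 / 2) (b := 0)).comp_sub_left 1
      norm_num at this ⊢
      exact this
    · rw [uIcc_of_le (by norm_num)]
      exact fun t ht => (Real.continuousAt_rpow_const _ _
        (Or.inl (by linarith [ht.1]))).continuousWithinAt

lemma exists_integral_log_sub_add_mul_rpow {r : ℝ} (hr : -1 < r) :
    ∃ c : ℝ, ∀ ρ > 0, ∫ t in 0..ρ, (Real.log (ρ - t) + c) * t ^ r =
      ∫ t in 0..ρ, Real.log t * t ^ r := by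
  set A := ∫ t in (0 : ℝ)..1, t ^ r with hA
  set B := ∫ t in (0 : ℝ)..1, Real.log (1 - t) * t ^ r with hB
  set B' := ∫ t in (0 : ℝ)..1, Real.log t * t ^ r with hB'
  have hA0 : A ≠ 0 := by
    rw [hA, integral_rpow (Or.inl hr)]
    have : r + 1 ≠ 0 := by linarith
    simp [Real.zero_rpow this, this]
  have hAi := intervalIntegral.intervalIntegrable_rpow' hr (a := 0) (b := 1)
  refine ⟨(B' - B) / A, fun ρ hρ => ?_⟩
  set c := (B' - B) / A with hc
  have h1 := intervalIntegral.mul_integral_comp_mul_left (a := 0) (b := 1)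
    (f := fun t => (Real.log (ρ - t) + c) * t ^ r) (c := ρ)
  have h2 := intervalIntegral.mul_integral_comp_mul_left (a := 0) (b := 1)
    (f := fun t => Real.log t * t ^ r) (c := ρ)
  rw [mul_zero, mul_one] at h1 h2
  rw [← h1, ← h2]
  congr 1
  have e1 : ∫ t in (0 : ℝ)..1, (Real.log (ρ - ρ * t) + c) * (ρ * t) ^ r =
      ∫ t in (0 : ℝ)..1, (ρ ^ r * (Real.log ρ + c)) * t ^ r
        + ρ ^ r * (Real.log (1 - t) * t ^ r) := by
    refine intervalIntegral.integral_congr_ae ?_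
    have hne : ∀ᵐ t : ℝ, t ≠ 1 := by simp [ae_iff, measure_singleton]
    filter_upwards [hne] with t ht1 ht
    rw [uIoc_of_le zero_le_one] at ht
    have : 1 - t ≠ 0 := sub_ne_zero.2 ht1.symm
    rw [show ρ - ρ * t = ρ * (1 - t) by ring, Real.log_mul hρ.ne' this,
      Real.mul_rpow hρ.le ht.1.le]
    ring
  have e2 : ∫ t in (0 : ℝ)..1, Real.log (ρ * t) * (ρ * t) ^ r =
      ∫ t in (0 : ℝ)..1, (ρ ^ r * Real.log ρ) * t ^ r + ρ ^ r * (Real.log t * t ^ r) := by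
    refine intervalIntegral.integral_congr_ae (ae_of_all _ fun t ht => ?_)
    rw [uIoc_of_le zero_le_one] at ht
    rw [Real.log_mul hρ.ne' ht.1.ne', Real.mul_rpow hρ.le ht.1.le]
    ring
  rw [e1, e2, intervalIntegral.integral_add (hAi.const_mul _)
      ((intervalIntegrable_log_one_sub_mul_rpow hr).const_mul _),
    intervalIntegral.integral_add (hAi.const_mul _)
      ((intervalIntegrable_log_mul_rpow hr zero_le_one).const_mul _)]
  simp only [intervalIntegral.integral_const_mul]
  rw [← hA, ← hB, ← hB', hc]
  field_simp
  ring

lemma hasDerivAt_integral_rpow_mul {a b : ℝ} {u u' : ℝ → ℝ → ℝ}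
    (hcont : ContinuousOn (fun p : ℝ × ℝ => u p.1 p.2) (Ioo 1 2 ×ˢ Icc a b))
    (hu : ∀ σ ∈ Ioo (1 : ℝ) 2, ∀ s ∈ Icc a b, HasDerivAt (fun τ => u τ s) (u' σ s) σ)
    (hcont' : ContinuousOn (fun p : ℝ × ℝ => u' p.1 p.2) (Ioo 1 2 ×ˢ Icc a b))
    {σ : ℝ} (hσ : σ ∈ Ioo (1 : ℝ) 2) {y : ℝ} (hy : y ∈ Icc a b) :
    HasDerivAt (fun τ => ∫ s in a..y, (y - s) ^ (1 - τ) * u τ s)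
      ((∫ s in a..y, (y - s) ^ (1 - σ) * u' σ s)
        - ∫ s in a..y, Real.log (y - s) * (y - s) ^ (1 - σ) * u σ s) σ := by
  obtain ⟨δ, hδ, hδ1, hδ2⟩ : ∃ δ > 0, 1 < σ - δ ∧ σ + δ < 2 :=
    ⟨min (σ - 1) (2 - σ) / 2, by have := lt_min (sub_pos.2 hσ.1) (sub_pos.2 hσ.2); linarith,
      by linarith [min_le_left (σ - 1) (2 - σ), sub_pos.2 hσ.1],
      by linarith [min_le_right (σ - 1) (2 - σ), sub_pos.2 hσ.2]⟩
  have hIoo : ∀ τ ∈ Icc (σ - δ) (σ + δ), τ ∈ Ioo (1 : ℝ) 2 := fun τ hτ =>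
    ⟨by linarith [hτ.1], by linarith [hτ.2]⟩
  have hsub : Icc (σ - δ) (σ + δ) ×ˢ Icc a b ⊆ Ioo 1 2 ×ˢ Icc a b :=
    prod_mono hIoo Subset.rfl
  have hcpt : IsCompact (Icc (σ - δ) (σ + δ) ×ˢ Icc a b) := isCompact_Icc.prod isCompact_Icc
  obtain ⟨C, hC⟩ := hcpt.exists_bound_of_continuousOn (hcont.mono hsub)
  obtain ⟨C', hC'⟩ := hcpt.exists_bound_of_continuousOn (hcont'.mono hsub)
  have hslice {g : ℝ → ℝ → ℝ}
      (hg : ContinuousOn (fun p : ℝ × ℝ => g p.1 p.2) (Ioo 1 2 ×ˢ Icc a b))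
      {τ : ℝ} (hτ : τ ∈ Ioo (1 : ℝ) 2) : ContinuousOn (g τ) (uIcc a y) := by
    rw [uIcc_of_le hy.1]
    exact hg.comp (f := fun s => (τ, s)) (by fun_prop)
      fun s hs => ⟨hτ, hs.1, hs.2.trans hy.2⟩
  have hpow {r : ℝ} (hr : -1 < r) :
      IntervalIntegrable (fun s => (y - s) ^ r) volume a y := by
    have := (intervalIntegral.intervalIntegrable_rpow' hr (a := y - a) (b := 0)).comp_sub_left y
    simpa using this
  have hlogpow {r : ℝ} (hr : -1 < r) :
      IntervalIntegrable (fun s => Real.log (y - s) * (y - s) ^ r) volume a y := by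
    have := ((intervalIntegrable_log_mul_rpow hr (sub_nonneg.2 hy.1)).symm).comp_sub_left y
    simpa using this
  have hmem : σ ∈ Icc (σ - δ) (σ + δ) := ⟨by linarith, by linarith⟩
  have hint1 := (hpow (r := 1 - σ) (by linarith [hσ.2])).mul_continuousOn (hslice hcont' hσ)
  have hint2 := (hlogpow (r := 1 - σ) (by linarith [hσ.2])).mul_continuousOn (hslice hcont hσ)
  rw [← intervalIntegral.integral_sub hint1 hint2]
  have hnhds : Icc (σ - δ) (σ + δ) ∈ 𝓝 σ := Icc_mem_nhds (by linarith) (by linarith)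
  have hne : ∀ᵐ s : ℝ, s ≠ y := by simp [ae_iff, measure_singleton]
  refine (intervalIntegral.hasDerivAt_integral_of_dominated_loc_of_deriv_le
    (F' := fun τ s => (y - s) ^ (1 - τ) * u' τ s
      - Real.log (y - s) * (y - s) ^ (1 - τ) * u τ s)
    (bound := fun s => ((y - s) ^ (1 - σ - δ) + (y - s) ^ (1 - σ + δ)) * C'
      + (|Real.log (y - s) * (y - s) ^ (1 - σ - δ)|
        + |Real.log (y - s) * (y - s) ^ (1 - σ + δ)|) * C)
    hnhds ?_ ?_ ?_ ?_ ?_ ?_).2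
  · filter_upwards [hnhds] with τ hτ
    have := (hpow (r := 1 - τ) (by linarith [(hIoo τ hτ).2])).mul_continuousOn
      (hslice hcont (hIoo τ hτ))
    exact (intervalIntegrable_iff.1 this).aestronglyMeasurable
  · exact (hpow (by linarith [hσ.2])).mul_continuousOn (hslice hcont hσ)
  · exact (intervalIntegrable_iff.1 (hint1.sub hint2)).aestronglyMeasurable
  · filter_upwards [hne] with s hsy hs τ hτ
    rw [uIoc_of_le hy.1] at hs
    have hpos : 0 < y - s := sub_pos.2 (lt_of_le_of_ne hs.2 hsy)
    have hp : (y - s) ^ (1 - τ) ≤ (y - s) ^ (1 - σ - δ) + (y - s) ^ (1 - σ + δ) := by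
      have p1 := Real.rpow_nonneg hpos.le (1 - σ - δ)
      have p2 := Real.rpow_nonneg hpos.le (1 - σ + δ)
      rcases le_total (y - s) 1 with h | h
      · have := Real.rpow_le_rpow_of_exponent_ge hpos h
          (show 1 - σ - δ ≤ 1 - τ by linarith [hτ.2])
        linarith
      · have := Real.rpow_le_rpow_of_exponent_le h
          (show 1 - τ ≤ 1 - σ + δ by linarith [hτ.1])
        linarith
    have hsb : s ∈ Icc a b := ⟨hs.1.le, hs.2.trans hy.2⟩
    have hp0 := Real.rpow_nonneg hpos.le (1 - τ)
    refine (norm_sub_le _ _).trans (add_le_add ?_ ?_)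
    · rw [norm_mul, Real.norm_of_nonneg hp0]
      exact mul_le_mul hp (hC' (τ, s) ⟨hτ, hsb⟩) (norm_nonneg _) (hp0.trans hp)
    · rw [norm_mul, norm_mul, Real.norm_of_nonneg hp0, abs_mul, abs_mul,
        abs_of_nonneg (Real.rpow_nonneg hpos.le (1 - σ - δ)),
        abs_of_nonneg (Real.rpow_nonneg hpos.le (1 - σ + δ)), ← mul_add]
      exact mul_le_mul (mul_le_mul_of_nonneg_left hp (abs_nonneg _)) (hC (τ, s) ⟨hτ, hsb⟩)
        (norm_nonneg _) (mul_nonneg (abs_nonneg _) (hp0.trans hp))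
  · exact (((hpow (by linarith)).add (hpow (by linarith))).mul_const _).add
      (((hlogpow (by linarith)).abs.add (hlogpow (by linarith)).abs).mul_const _)
  · filter_upwards [hne] with s hsy hs τ hτ
    rw [uIoc_of_le hy.1] at hs
    have hpos : 0 < y - s := sub_pos.2 (lt_of_le_of_ne hs.2 hsy)
    have hd := (((hasDerivAt_id τ).const_sub 1).const_rpow hpos).mul
      (hu τ (hIoo τ hτ) s ⟨hs.1.le, hs.2.trans hy.2⟩)
    refine hd.congr_deriv ?_
    simp only [id]
    ring

lemma hasDerivAt_integral_mul_comp_sub {k f f' : ℝ → ℝ} {ε p q y : ℝ} {C : NNReal}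
    (hε : 0 ≤ ε) (hk : IntervalIntegrable k volume 0 ε)
    (hf : ∀ s ∈ Ioo p q, HasDerivAt f (f' s) s) (hL : LipschitzOnWith C f (Ioo p q))
    (hy : y ∈ Ioo (p + ε) q) :
    HasDerivAt (fun y => ∫ t in 0..ε, k t * f (y - t)) (∫ t in 0..ε, k t * f' (y - t)) y := by
  have hmem {z t : ℝ} (hz : z ∈ Ioo (p + ε) q) (ht : t ∈ Icc 0 ε) : z - t ∈ Ioo p q :=
    ⟨by linarith [hz.1, ht.2], by linarith [hz.2, ht.1]⟩
  have hcont {z : ℝ} (hz : z ∈ Ioo (p + ε) q) :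
      ContinuousOn (fun t => f (z - t)) (uIcc 0 ε) := by
    rw [uIcc_of_le hε]
    exact hL.continuousOn.comp (by fun_prop) fun t ht => hmem hz ht
  have hnhds : Ioo (p + ε) q ∈ 𝓝 y := Ioo_mem_nhds hy.1 hy.2
  refine (intervalIntegral.hasDerivAt_integral_of_dominated_loc_of_lip
    (bound := fun t => |k t| * C) hnhds ?_ (hk.mul_continuousOn (hcont hy)) ?_ ?_
    (hk.abs.mul_const _) ?_).2
  · filter_upwards [hnhds] with z hz
    exact (intervalIntegrable_iff.1 (hk.mul_continuousOn (hcont hz))).aestronglyMeasurable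
  · have hd : AEStronglyMeasurable (fun t => deriv f (y - t)) (volume.restrict (uIoc 0 ε)) :=
      ((measurable_deriv f).comp (measurable_const.sub measurable_id)).aestronglyMeasurable
    refine (intervalIntegrable_iff.1 hk).aestronglyMeasurable.mul (hd.congr ?_)
    filter_upwards [ae_restrict_mem measurableSet_uIoc] with t ht
    rw [uIoc_of_le hε] at ht
    exact (hf _ (hmem hy (Ioc_subset_Icc_self ht))).deriv
  · refine ae_of_all _ fun t ht => ?_
    rw [uIoc_of_le hε] at ht
    refine LipschitzOnWith.of_dist_le_mul fun z hz z' hz' => ?_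
    have h := hL.dist_le_mul _ (hmem hz (Ioc_subset_Icc_self ht)) _
      (hmem hz' (Ioc_subset_Icc_self ht))
    rw [dist_sub_right] at h
    rw [Real.dist_eq, ← mul_sub, abs_mul, Real.coe_nnabs,
      abs_of_nonneg (mul_nonneg (abs_nonneg (k t)) C.coe_nonneg), mul_assoc]
    exact mul_le_mul_of_nonneg_left h (abs_nonneg _)
  · refine ae_of_all _ fun t ht => ?_
    rw [uIoc_of_le hε] at ht
    exact ((hf _ (hmem hy (Ioc_subset_Icc_self ht))).comp_sub_const y t).const_mul (k t)

lemma hasDerivAt_integral_comp_sub_mul {κ κ' w : ℝ → ℝ} {a b : ℝ}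
    (hκ : ∀ t, HasDerivAt κ (κ' t) t) (hκ' : Continuous κ')
    (hw : IntervalIntegrable w volume a b) (y : ℝ) :
    HasDerivAt (fun y => ∫ s in a..b, κ (y - s) * w s) (∫ s in a..b, κ' (y - s) * w s) y := by
  have hκc : Continuous κ := continuous_iff_continuousAt.2 fun t => (hκ t).continuousAt
  obtain ⟨C, hC⟩ := ((isCompact_Icc (a := y - 1) (b := y + 1)).prod
    (isCompact_uIcc (a := a) (b := b))).exists_bound_of_continuousOn
      (f := fun z : ℝ × ℝ => κ' (z.1 - z.2)) (by fun_prop)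
  refine (intervalIntegral.hasDerivAt_integral_of_dominated_loc_of_deriv_le
    (F' := fun z s => κ' (z - s) * w s) (bound := fun s => C * |w s|)
    (Icc_mem_nhds (sub_one_lt y) (lt_add_one y)) (Eventually.of_forall fun z => ?_) ?_ ?_
    (ae_of_all _ fun s hs z hz => ?_) (hw.abs.const_mul C) (ae_of_all _ fun s hs z hz => ?_)).2
  · exact (intervalIntegrable_iff.1 (hw.continuousOn_mul
      (f := w) (g := fun s => κ (z - s)) (by fun_prop))).aestronglyMeasurable
  · exact hw.continuousOn_mul (by fun_prop)
  · exact (intervalIntegrable_iff.1 (hw.continuousOn_mul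
      (f := w) (g := fun s => κ' (y - s)) (by fun_prop))).aestronglyMeasurable
  · rw [norm_mul]
    exact mul_le_mul_of_nonneg_right (hC (z, s) ⟨hz, uIoc_subset_uIcc hs⟩) (norm_nonneg _)
  · exact ((hκ (z - s)).comp_sub_const z s).mul_const (w s)

lemma exists_lipschitzOnWith_Ioo {g : ℝ → ℝ} {p q : ℝ} (hpq : p < q)
    (hg : ∀ s ∈ Icc p q, DifferentiableAt ℝ g s) :
    ∃ p' q', p ≤ p' ∧ p' < q' ∧ q' ≤ q ∧ ∃ C, LipschitzOnWith C g (Ioo p' q') := by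
  set π : ℝ → ℝ := fun y => projIcc p q hpq.le y with hπ
  have hπmem (y : ℝ) : π y ∈ Icc p q := (projIcc p q hpq.le y).2
  have hπeq {y : ℝ} (hy : y ∈ Icc p q) : π y = y := by
    simp only [hπ, projIcc_of_mem hpq.le hy]
  have hπc : Continuous π := continuous_subtype_val.comp continuous_projIcc
  have hπdist (y z : ℝ) : |π z - π y| ≤ |z - y| := abs_projIcc_sub_projIcc hpq.le
  have hgc : ContinuousOn g (Icc p q) := fun s hs => (hg s hs).continuousAt.continuousWithinAt
  have hgπ : Continuous fun y => g (π y) := hgc.comp_continuous hπc hπmem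
  obtain ⟨B, hB⟩ := isCompact_Icc.exists_bound_of_continuousOn hgc
  let E : ℕ → Set ℝ := fun n => {y | ∀ z, |g (π z) - g (π y)| ≤ n * |z - y|}
  have hclosed (n : ℕ) : IsClosed (E n) := by
    simp only [E, ofPred_forall]
    exact isClosed_iInter fun z => isClosed_le (continuous_const.sub hgπ).abs (by fun_prop)
  have hunion : ⋃ n, E n = univ := by
    refine eq_univ_of_forall fun y => mem_iUnion.2 ?_
    obtain ⟨c, hc⟩ := (hg _ (hπmem y)).isBigO_sub.bound
    obtain ⟨δ, hδ, hδc⟩ := Metric.eventually_nhds_iff.1 hc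
    obtain ⟨n, hn⟩ := exists_nat_ge (max c (2 * B / δ))
    refine ⟨n, fun z => ?_⟩
    have hn1 := (le_max_left _ _).trans hn
    have hn2 := (le_max_right _ _).trans hn
    have hn0 : (0 : ℝ) ≤ n := n.cast_nonneg
    refine le_trans ?_ (mul_le_mul_of_nonneg_left (hπdist y z) hn0)
    rcases lt_or_ge |π z - π y| δ with h | h
    · exact (hδc (y := π z) h).trans (mul_le_mul_of_nonneg_right hn1 (norm_nonneg _))
    · have h1 := hB _ (hπmem z)
      have h2 := hB _ (hπmem y)
      rw [div_le_iff₀ hδ] at hn2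
      have h3 := norm_sub_le (g (π z)) (g (π y))
      rw [Real.norm_eq_abs] at h3
      nlinarith
  obtain ⟨y, hy, hyE⟩ := (dense_iUnion_interior_of_closed hclosed hunion).inter_open_nonempty
    (Ioo p q) isOpen_Ioo (nonempty_Ioo.2 hpq)
  obtain ⟨n, hn⟩ := mem_iUnion.1 hyE
  obtain ⟨p', q', hyI, hsub⟩ := mem_nhds_iff_exists_Ioo_subset.1
    (inter_mem (isOpen_interior.mem_nhds hn) (isOpen_Ioo.mem_nhds hy))
  have hlt := hyI.1.trans hyI.2
  have hpp := (Ioo_subset_Ioo_iff hlt).1 fun z hz => (hsub hz).2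
  refine ⟨p', q', hpp.1, hlt, hpp.2, n, LipschitzOnWith.of_dist_le_mul fun z hz z' hz' => ?_⟩
  have h := interior_subset (hsub hz').1 z
  rwa [hπeq (Ioo_subset_Icc_self (hsub hz).2), hπeq (Ioo_subset_Icc_self (hsub hz').2)] at h

lemma contDiff_smoothTransition_mul {k : ℝ → ℝ} {n : ℕ} {ε : ℝ} (hε : 0 < ε)
    (hk : ContDiffOn ℝ n k (Ioi 0)) :
    ContDiff ℝ n fun t => Real.smoothTransition (2 * t / ε - 1) * k t := by
  refine contDiff_iff_contDiffAt.2 fun t => ?_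
  rcases lt_or_ge t (ε / 2) with h | h
  · refine (contDiffAt_const (c := (0 : ℝ))).congr_of_eventuallyEq ?_
    filter_upwards [Iio_mem_nhds h] with s hs
    rw [Real.smoothTransition.zero_of_nonpos, zero_mul]
    have : 2 * s / ε < 1 := by rw [div_lt_one hε]; linarith [mem_Iio.1 hs]
    linarith
  · refine ContDiffAt.mul ?_ (hk.contDiffAt (Ioi_mem_nhds (by linarith)))
    exact Real.smoothTransition.contDiffAt.comp t (by fun_prop)

lemma exists_hasDerivAt_volterra {k w g h : ℝ → ℝ} {a b p q y₀ : ℝ} {C C' : NNReal}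
    (hk : ContDiffOn ℝ 2 k (Ioi 0)) (hki : IntegrableOn k (Ioc 0 (b - a)))
    (hw : IntervalIntegrable w volume a b) (hap : a ≤ p) (hqb : q ≤ b)
    (hwg : ∀ s ∈ Ioo p q, HasDerivAt w (g s) s) (hgh : ∀ s ∈ Ioo p q, HasDerivAt g (h s) s)
    (hwL : LipschitzOnWith C w (Ioo p q)) (hgL : LipschitzOnWith C' g (Ioo p q))
    (hy₀ : y₀ ∈ Ioo p q) :
    ∃ D : ℝ → ℝ, (∀ᶠ y in 𝓝 y₀, HasDerivAt (fun y => ∫ s in a..y, k (y - s) * w s) (D y) y) ∧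
      DifferentiableAt ℝ D y₀ := by
  obtain ⟨ε, hε, hεp⟩ : ∃ ε > 0, p + ε < y₀ :=
    ⟨(y₀ - p) / 2, by linarith [hy₀.1], by linarith [hy₀.1]⟩
  set χ : ℝ → ℝ := fun t => Real.smoothTransition (2 * t / ε - 1)
  have hχc : Continuous χ := Real.smoothTransition.continuous.comp (by fun_prop)
  have hχ0 {t : ℝ} (ht : t ≤ 0) : χ t = 0 := by
    refine Real.smoothTransition.zero_of_nonpos ?_
    have : 2 * t / ε ≤ 0 := div_nonpos_of_nonpos_of_nonneg (by linarith) hε.le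
    linarith
  have hχ1 {t : ℝ} (ht : ε ≤ t) : χ t = 1 := by
    refine Real.smoothTransition.one_of_one_le ?_
    have : 2 ≤ 2 * t / ε := by rw [le_div_iff₀ hε]; linarith
    linarith
  set κ₀ : ℝ → ℝ := fun t => (1 - χ t) * k t with hκ₀
  set κ₁ : ℝ → ℝ := fun t => χ t * k t with hκ₁
  have hκ₁c : ContDiff ℝ 2 κ₁ := contDiff_smoothTransition_mul (n := 2) hε hk
  have hκ₁d : ContDiff ℝ 1 (deriv κ₁) :=
    ((contDiff_succ_iff_deriv (n := 1)).1 (by simpa [one_add_one_eq_two] using hκ₁c)).2.2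
  have hκ₀i : IntervalIntegrable κ₀ volume 0 ε := by
    have hki' : IntervalIntegrable k volume 0 ε := by
      rw [intervalIntegrable_iff_integrableOn_Ioc_of_le hε.le]
      exact hki.mono_set (Ioc_subset_Ioc_right (by linarith [hy₀.2]))
    exact hki'.continuousOn_mul (by fun_prop)
  have hnhds : Ioo (p + ε) q ∈ 𝓝 y₀ := Ioo_mem_nhds hεp hy₀.2
  have hsplit {y : ℝ} (hy : y ∈ Ioo (p + ε) q) :
      ∫ s in a..y, k (y - s) * w s =
        (∫ t in 0..ε, κ₀ t * w (y - t)) + ∫ s in a..b, κ₁ (y - s) * w s := by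
    have hay : a ≤ y - ε := by linarith [hy.1]
    have hyb : y ≤ b := hy.2.le.trans hqb
    have hi₁ : IntervalIntegrable (fun s => κ₁ (y - s) * w s) volume a b :=
      hw.continuousOn_mul (hκ₁c.continuous.comp (by fun_prop)).continuousOn
    have hzero : ∀ s ∈ uIoc a (y - ε), κ₀ (y - s) * w s = 0 := fun s hs => by
      rw [uIoc_of_le hay] at hs
      simp [hκ₀, hχ1 (show ε ≤ y - s by linarith [hs.2])]
    have hi₀ : IntervalIntegrable (fun s => κ₀ (y - s) * w s) volume a (y - ε) :=
      (IntervalIntegrable.zero (μ := volume)).congr fun s hs => (hzero s hs).symm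
    have hi₀' : IntervalIntegrable (fun s => κ₀ (y - s) * w s) volume (y - ε) y := by
      have h0 : IntervalIntegrable (fun s => κ₀ (y - s)) volume (y - ε) y := by
        simpa using (hκ₀i.comp_sub_left y).symm
      refine h0.mul_continuousOn (hwL.continuousOn.mono fun s hs => ?_)
      rw [uIcc_of_le (by linarith)] at hs
      exact ⟨by linarith [hs.1, hy.1], by linarith [hs.2, hy.2]⟩
    have hκ₀int : ∫ s in a..y, κ₀ (y - s) * w s = ∫ t in 0..ε, κ₀ t * w (y - t) := by
      rw [← intervalIntegral.integral_add_adjacent_intervals hi₀ hi₀',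
        intervalIntegral.integral_zero_ae (ae_of_all _ hzero), zero_add]
      have := intervalIntegral.integral_comp_sub_left (a := 0) (b := ε)
        (fun s => κ₀ (y - s) * w s) y
      simpa using this.symm
    have hκ₁int : ∫ s in y..b, κ₁ (y - s) * w s = 0 := by
      refine intervalIntegral.integral_zero_ae (ae_of_all _ fun s hs => ?_)
      rw [uIoc_of_le hyb] at hs
      simp [hκ₁, hχ0 (show y - s ≤ 0 by linarith [hs.1])]
    have hya : y ∈ uIcc a b := by
      rw [uIcc_of_le (by linarith)]
      exact ⟨by linarith, hyb⟩
    have hi₁y := hi₁.mono_set (uIcc_subset_uIcc_left hya)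
    rw [← intervalIntegral.integral_add_adjacent_intervals hi₁y
      (hi₁.mono_set (uIcc_subset_uIcc_right hya)), hκ₁int, add_zero, ← hκ₀int,
      ← intervalIntegral.integral_add (hi₀.trans hi₀') hi₁y]
    refine intervalIntegral.integral_congr fun s _ => ?_
    simp only [hκ₀, hκ₁]
    ring
  have hκ₁' (t : ℝ) : HasDerivAt κ₁ (deriv κ₁ t) t :=
    (hκ₁c.differentiable (by norm_num) t).hasDerivAt
  have hκ₁'' (t : ℝ) : HasDerivAt (deriv κ₁) (deriv (deriv κ₁) t) t :=
    (hκ₁d.differentiable (by norm_num) t).hasDerivAt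
  refine ⟨fun y => (∫ t in 0..ε, κ₀ t * g (y - t)) + ∫ s in a..b, deriv κ₁ (y - s) * w s, ?_, ?_⟩
  · filter_upwards [hnhds] with y hy
    refine ((hasDerivAt_integral_mul_comp_sub hε.le hκ₀i hwg hwL hy).add
      (hasDerivAt_integral_comp_sub_mul hκ₁' hκ₁d.continuous hw y)).congr_of_eventuallyEq ?_
    filter_upwards [Ioo_mem_nhds hy.1 hy.2] with z hz using hsplit hz
  · exact ((hasDerivAt_integral_mul_comp_sub hε.le hκ₀i hgh hgL ⟨hεp, hy₀.2⟩).add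
      (hasDerivAt_integral_comp_sub_mul hκ₁'' (hκ₁d.continuous_deriv le_rfl) hw
        y₀)).differentiableAt

/-- If the Riemann-Liouville kernel applied to `v` is twice differentiable on an interval, then
the logarithmic kernel applied to `v` is differentiable somewhere in that interval. -/
lemma exists_differentiableAt_log_volterra {v g h : ℝ → ℝ} {a b p q r : ℝ} (hr : -1 < r)
    (hv : ContinuousOn v (Icc a b)) (hap : a ≤ p) (hpq : p < q) (hqb : q ≤ b)
    (hwg : ∀ y ∈ Icc p q, HasDerivAt (fun y => ∫ s in a..y, (y - s) ^ r * v s) (g y) y)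
    (hgh : ∀ y ∈ Icc p q, HasDerivAt g (h y) y) :
    ∃ y ∈ Ioo p q,
      DifferentiableAt ℝ (fun y => ∫ s in a..y, Real.log (y - s) * (y - s) ^ r * v s) y := by
  have hab : a ≤ b := by linarith
  have hR : 0 ≤ b - a := sub_nonneg.2 hab
  obtain ⟨c, hc⟩ := exists_integral_log_sub_add_mul_rpow hr
  have hpow : IntegrableOn (fun t : ℝ => t ^ r) (Ioc 0 (b - a)) :=
    (intervalIntegrable_iff_integrableOn_Ioc_of_le hR).1
      (intervalIntegral.intervalIntegrable_rpow' hr)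
  have hlogpow : IntegrableOn (fun t : ℝ => Real.log t * t ^ r) (Ioc 0 (b - a)) :=
    (intervalIntegrable_iff_integrableOn_Ioc_of_le hR).1 (intervalIntegrable_log_mul_rpow hr hR)
  have hlog : IntegrableOn (fun t : ℝ => Real.log t + c) (Ioc 0 (b - a)) :=
    (intervalIntegrable_iff_integrableOn_Ioc_of_le hR).1
      (intervalIntegral.intervalIntegrable_log'.add intervalIntegrable_const)
  have hone : IntegrableOn (fun _ : ℝ => (1 : ℝ)) (Ioc 0 (b - a)) :=
    (intervalIntegrable_iff_integrableOn_Ioc_of_le hR).1 intervalIntegrable_const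
  set w : ℝ → ℝ := fun y => ∫ s in a..y, (y - s) ^ r * v s with hw
  set F : ℝ → ℝ := fun y => ∫ s in a..y, Real.log (y - s) * (y - s) ^ r * v s with hF
  have hwi : IntervalIntegrable w volume a b := intervalIntegrable_volterra hab hpow hv
  have hFi : IntervalIntegrable F volume a b := intervalIntegrable_volterra hab hlogpow hv
  have hFint {y : ℝ} (hy : y ∈ Icc a b) :
      ∫ s in a..y, (Real.log (y - s) + c) * w s = ∫ s in a..y, F s := by
    have h1 := integral_volterra_volterra hlog hpow hv hy
    have h2 := integral_volterra_volterra hone hlogpow hv hy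
    simp only [one_mul] at h2
    rw [h1, h2]
    have hne : ∀ᵐ s : ℝ, s ≠ y := by simp [ae_iff, measure_singleton]
    refine intervalIntegral.integral_congr_ae ?_
    filter_upwards [hne] with s hsy hs
    rw [uIoc_of_le hy.1] at hs
    rw [hc (y - s) (sub_pos.2 (lt_of_le_of_ne hs.2 hsy))]
  obtain ⟨p', q', hpp, hpq', hqq, C', hC'⟩ :=
    exists_lipschitzOnWith_Ioo hpq fun y hy => (hgh y hy).differentiableAt
  have hsub : Ioo p' q' ⊆ Icc p q := Ioo_subset_Icc_self.trans (Icc_subset_Icc hpp hqq)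
  obtain ⟨B, hB⟩ := isCompact_Icc.exists_bound_of_continuousOn (f := g) (s := Icc p q)
    fun y hy => (hgh y hy).continuousAt.continuousWithinAt
  have hwL : LipschitzOnWith B.toNNReal w (Ioo p' q') :=
    (convex_Ioo p' q').lipschitzOnWith_of_nnnorm_hasDerivWithin_le
      (fun y hy => (hwg y (hsub hy)).hasDerivWithinAt)
      fun y hy => by
        rw [← NNReal.coe_le_coe, coe_nnnorm]
        exact (hB y (hsub hy)).trans (Real.le_coe_toNNReal B)
  obtain ⟨y₀, hy₀⟩ := nonempty_Ioo.2 hpq'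
  have hlogC : ContDiffOn ℝ 2 (fun t : ℝ => Real.log t + c) (Ioi 0) :=
    (contDiffOn_id.log fun t ht => (mem_Ioi.1 ht).ne').add contDiffOn_const
  obtain ⟨D, hD, hDd⟩ := exists_hasDerivAt_volterra hlogC hlog hwi (hap.trans hpp)
    (hqq.trans hqb) (fun y hy => hwg y (hsub hy)) (fun y hy => hgh y (hsub hy)) hwL hC' hy₀
  refine ⟨y₀, Ioo_subset_Ioo hpp hqq hy₀, hDd.congr_of_eventuallyEq ?_⟩
  filter_upwards [hD, Ioo_mem_nhds hy₀.1 hy₀.2] with y hDy hy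
  have hyab : y ∈ Ioo a b := ⟨(hap.trans hpp).trans_lt hy.1, hy.2.trans_le (hqq.trans hqb)⟩
  have hFc (z : ℝ) (hz : z ∈ Ioo a b) : ContinuousAt F z := continuousAt_volterra hlogpow hv hz
  have hyu : y ∈ uIcc a b := by
    rw [uIcc_of_le hab]
    exact Ioo_subset_Icc_self hyab
  have hFy := intervalIntegral.integral_hasDerivAt_right
    (hFi.mono_set (uIcc_subset_uIcc_left hyu))
    (ContinuousAt.stronglyMeasurableAtFilter isOpen_Ioo hFc y hyab) (hFc y hyab)
  refine hFy.unique (hDy.congr_of_eventuallyEq ?_)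
  filter_upwards [Ioo_mem_nhds hyab.1 hyab.2] with z hz
  exact (hFint (Ioo_subset_Icc_self hz)).symm

/-- sensitivity formula (4.2) of the paper, case `n = 2`, left-sided.
With `I(σ,y) = ∫_a^y (y-s)^{1-σ} u(σ,s) ds`, first and second spatial partials `Ix`,
`Ixx`, partial `Iσ = ∂I/∂σ` and its spatial derivative `Iσx` (valid on a neighborhood
`V` of `(σ₀,x)`), commuting third-order mixed partials (common value `M`), and with
`D1`, `D2` the second derivatives at `x` of
`y ↦ ∫_a^y (y-s)^{1-σ₀} (∂u/∂σ)(σ₀,s) ds` and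
`y ↦ ∫_a^y log(y-s)(y-s)^{1-σ₀} u(σ₀,s) ds`, the map
`σ ↦ (1/Γ(2-σ)) Ixx(σ,x)` is differentiable at `σ₀` with derivative
`(1/Γ(2-σ₀)) D1 + A₂(σ₀)(1/Γ(2-σ₀)) Ixx(σ₀,x) - (1/Γ(2-σ₀)) D2`, where
`A₂(σ) = Γ(2-σ) (d/dσ)(1/Γ(2-σ))`. -/
theorem stmt4 (a b : ℝ) (hab : a < b) (x : ℝ) (hx : x ∈ Set.Ioc a b)
    (u uσ : ℝ → ℝ → ℝ)
    (hcont : ContinuousOn (fun p : ℝ × ℝ => u p.1 p.2) (Set.Ioo 1 2 ×ˢ Set.Icc a b))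
    (huσ : ∀ σ ∈ Set.Ioo (1:ℝ) 2, ∀ s ∈ Set.Icc a b,
      HasDerivAt (fun τ => u τ s) (uσ σ s) σ)
    (hcontσ : ContinuousOn (fun p : ℝ × ℝ => uσ p.1 p.2) (Set.Ioo 1 2 ×ˢ Set.Icc a b))
    (σ₀ : ℝ) (hσ₀ : σ₀ ∈ Set.Ioo (1:ℝ) 2)
    (Ix Ixx Iσ Iσx : ℝ → ℝ → ℝ)
    (V : Set (ℝ × ℝ)) (hV : V ∈ nhds (σ₀, x))
    (hIx : ∀ p ∈ V,
      HasDerivAt (fun y => ∫ s in a..y, (y - s) ^ (1 - p.1) * u p.1 s) (Ix p.1 p.2) p.2)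
    (hIxx : ∀ p ∈ V, HasDerivAt (fun y => Ix p.1 y) (Ixx p.1 p.2) p.2)
    (hIσ : ∀ p ∈ V,
      HasDerivAt (fun τ => ∫ s in a..p.2, (p.2 - s) ^ (1 - τ) * u τ s) (Iσ p.1 p.2) p.1)
    (hIσx : ∀ p ∈ V, HasDerivAt (fun y => Iσ p.1 y) (Iσx p.1 p.2) p.2)
    (M : ℝ)
    (hM1 : HasDerivAt (fun τ => Ixx τ x) M σ₀)
    (hM2 : HasDerivAt (fun y => Iσx σ₀ y) M x)
    (D1 D2 : ℝ)
    (hD1 : HasDerivAt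
      (deriv (fun y => ∫ s in a..y, (y - s) ^ (1 - σ₀) * uσ σ₀ s)) D1 x)
    (hD2 : HasDerivAt
      (deriv (fun y => ∫ s in a..y, Real.log (y - s) * (y - s) ^ (1 - σ₀) * u σ₀ s)) D2 x) :
    HasDerivAt (fun σ => (1 / Real.Gamma (2 - σ)) * Ixx σ x)
      ((1 / Real.Gamma (2 - σ₀)) * D1
        + (Real.Gamma (2 - σ₀) * deriv (fun τ => 1 / Real.Gamma (2 - τ)) σ₀)
            * ((1 / Real.Gamma (2 - σ₀)) * Ixx σ₀ x)
        - (1 / Real.Gamma (2 - σ₀)) * D2) σ₀ := by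
  have hx₀ : 𝓝[<] x ≤ 𝓝[≠] x := nhdsWithin_mono x fun y hy => ne_of_lt hy
  have hVx : ∀ᶠ y in 𝓝 x, (σ₀, y) ∈ V :=
    (show Continuous fun y : ℝ => (σ₀, y) by fun_prop).continuousAt.preimage_mem_nhds hV
  obtain ⟨l, hl, hlV⟩ : ∃ l < x, ∀ y ∈ Ioc l x, (σ₀, y) ∈ V := by
    obtain ⟨l, hl, hsub⟩ := (mem_nhdsLE_iff_exists_Ioc_subset).1 (nhdsWithin_le_nhds hVx)
    exact ⟨l, hl, hsub⟩
  have hslice : ContinuousOn (u σ₀) (Icc a b) :=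
    hcont.comp (f := fun s => (σ₀, s)) (by fun_prop) fun s hs => ⟨hσ₀, hs⟩
  set F₁ : ℝ → ℝ := fun y => ∫ s in a..y, (y - s) ^ (1 - σ₀) * uσ σ₀ s with hF₁
  set F₂ : ℝ → ℝ := fun y => ∫ s in a..y, Real.log (y - s) * (y - s) ^ (1 - σ₀) * u σ₀ s with hF₂
  have hIσeq {y : ℝ} (hy : y ∈ Ioo (max l a) x) : Iσ σ₀ y = F₁ y - F₂ y :=
    (hIσ (σ₀, y) (hlV y ⟨(le_max_left _ _).trans_lt hy.1, hy.2.le⟩)).unique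
      (hasDerivAt_integral_rpow_mul hcont huσ hcontσ hσ₀
        ⟨((le_max_right _ _).trans_lt hy.1).le, hy.2.le.trans hx.2⟩)
  have hfreq : ∃ᶠ y in 𝓝[≠] x, Iσx σ₀ y - (deriv F₁ y - deriv F₂ y) = 0 := by
    refine Frequently.filter_mono (f := 𝓝[<] x) ?_ hx₀
    refine frequently_iff.2 fun {U} hU => ?_
    obtain ⟨m, hm, hmU⟩ := (mem_nhdsLT_iff_exists_Ioo_subset).1 hU
    have hmx : max m (max l a) < x := max_lt hm (max_lt hl hx.1)
    obtain ⟨p, hp, hpx⟩ := exists_between hmx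
    obtain ⟨q, hpq, hqx⟩ := exists_between hpx
    have hmp : m < p := (le_max_left _ _).trans_lt hp
    have hlp : max l a < p := (le_max_right _ _).trans_lt hp
    have hVI : ∀ y ∈ Icc p q, (σ₀, y) ∈ V := fun y hy =>
      hlV y ⟨((le_max_left _ _).trans_lt hlp).trans_le hy.1, hy.2.trans hqx.le⟩
    obtain ⟨y, hy, hF₂y⟩ := exists_differentiableAt_log_volterra (r := 1 - σ₀)
      (by linarith [hσ₀.2]) hslice ((le_max_right _ _).trans hlp.le) hpq (hqx.le.trans hx.2)
      (fun y hy => hIx (σ₀, y) (hVI y hy)) (fun y hy => hIxx (σ₀, y) (hVI y hy))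
    have hyx : y < x := hy.2.trans hqx
    have hd : HasDerivAt (fun y => F₁ y - F₂ y) (Iσx σ₀ y) y := by
      refine (hIσx (σ₀, y) (hVI y (Ioo_subset_Icc_self hy))).congr_of_eventuallyEq ?_
      filter_upwards [Ioo_mem_nhds (hlp.trans hy.1) hyx] with z hz using (hIσeq hz).symm
    have hF₁y : HasDerivAt F₁ (Iσx σ₀ y + deriv F₂ y) y :=
      (hd.add hF₂y.hasDerivAt).congr_of_eventuallyEq
        (Eventually.of_forall fun z => (sub_add_cancel (F₁ z) (F₂ z)).symm)
    refine ⟨y, hmU ⟨hmp.trans hy.1, hyx⟩, ?_⟩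
    rw [hF₁y.deriv]
    ring
  have hM : M = D1 - D2 := by
    by_contra hne
    exact hfreq ((hM2.sub (hD1.sub hD2)).eventually_ne (sub_ne_zero.2 hne))
  have hpos : 0 < 2 - σ₀ := by linarith [hσ₀.2]
  have hΓ : Real.Gamma (2 - σ₀) ≠ 0 := (Real.Gamma_pos_of_pos hpos).ne'
  have hΓd : DifferentiableAt ℝ (fun τ => 1 / Real.Gamma (2 - τ)) σ₀ := by
    refine (differentiableAt_const _).div (DifferentiableAt.comp σ₀ (g := Real.Gamma)
      (f := fun τ => 2 - τ) (Real.differentiableAt_Gamma fun m => ?_) (by fun_prop)) hΓ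
    have : (0 : ℝ) ≤ m := m.cast_nonneg
    linarith
  refine (hΓd.hasDerivAt.mul hM1).congr_deriv ?_
  rw [hM]
  field_simp
  ring
end

section
/- Let a < b, x ∈ [a,b), and let u : (1,2) × [a,b] → ℝ be jointly continuous with jointly continuous partial derivative ∂u/∂σ. Fix σ₀ ∈ (1,2) and set J(σ,y) = ∫_y^b (s−y)^{1−σ} u(σ,s) ds. Assume J has partial derivatives ∂²J/∂x² and ∂J/∂σ in a neighborhood of (σ₀,x), that all relevant mixed partial derivatives of J of order three exist at (σ₀,x) and commute, and that the maps y ↦ ∫_y^b (s−y)^{1−σ₀}·(∂u/∂σ)(σ₀,s) ds and y ↦ ∫_y^b log(s−y)·(s−y)^{1−σ₀}·u(σ₀,s) ds are twice differentiable at y = x. Then the map σ ↦ (1/Γ(2−σ))·(∂²J/∂x²)(σ,x) is differentiable at σ₀ with derivative (1/Γ(2−σ₀)) · d²/dx² ∫_x^b (s−x)^{1−σ₀}·(∂u/∂σ)(σ₀,s) ds + A₂(σ₀) · (1/Γ(2−σ₀))·(∂²J/∂x²)(σ₀,x) − (1/Γ(2−σ₀)) · d²/dx² ∫_x^b log(s−x)·(s−x)^{1−σ₀}·u(σ₀,s)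 ds, where A₂(σ) := Γ(2−σ) · (d/dσ)(1/Γ(2−σ)). -/
open MeasureTheory Set Filter Topology

/-- The right-sided convolution `y ↦ ∫_y^b k(s-y) f(s) ds`. -/
noncomputable def rightConv (k f : ℝ → ℝ) (b y : ℝ) : ℝ := ∫ s in y..b, k (s - y) * f s

lemma intervalIntegrable_rightConv_integrand {k f : ℝ → ℝ} {b y : ℝ}
    (hk : ∀ T, IntegrableOn k (Ioc 0 T)) (hyb : y ≤ b) (hf : ContinuousOn f (Icc y b)) :
    IntervalIntegrable (fun s => k (s - y) * f s) volume y b := by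
  have h : IntervalIntegrable k volume 0 (b - y) :=
    (intervalIntegrable_iff_integrableOn_Ioc_of_le (by linarith)).2 (hk _)
  have h2 := h.comp_sub_right y
  simp only [zero_add, sub_add_cancel] at h2
  exact h2.mul_continuousOn (by rwa [uIcc_of_le hyb])

lemma rightConv_rightConv {m k v : ℝ → ℝ} {b y : ℝ} (hm : ∀ T, IntegrableOn m (Ioc 0 T))
    (hk : ∀ T, IntegrableOn k (Ioc 0 T)) (hv : Continuous v) (hyb : y ≤ b) :
    rightConv m (rightConv k v b) b y =
      rightConv (fun t => ∫ q in 0..t, m q * k (t - q)) v b y := by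
  set T := b - y with hT
  set m₁ : ℝ → ℝ := (Ioc 0 T).indicator m with hm₁
  set k₁ : ℝ → ℝ := (Ioc 0 T).indicator k with hk₁
  set v₁ : ℝ → ℝ := (Icc y b).indicator v with hv₁
  have im : Integrable (fun s => m₁ (s - y)) :=
    ((integrable_indicator_iff measurableSet_Ioc).2 (hm T)).comp_sub_right y
  have ik : Integrable k₁ := (integrable_indicator_iff measurableSet_Ioc).2 (hk T)
  obtain ⟨c, hc⟩ := (isCompact_Icc (a := y) (b := b)).exists_bound_of_continuousOn hv.continuousOn
  have hc0 : 0 ≤ c := (norm_nonneg _).trans (hc y (left_mem_Icc.2 hyb))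
  have vb : ∀ r, ‖v₁ r‖ ≤ c := fun r => by
    by_cases hr : r ∈ Icc y b
    · simpa [hv₁, hr] using hc r hr
    · simpa [hv₁, hr] using hc0
  have hΦ : Integrable
      (Function.uncurry fun r s => (m₁ (s - y) * k₁ (r - s)) * v₁ r) (volume.prod volume) := by
    refine (im.convolution_integrand (ContinuousLinearMap.mul ℝ ℝ) ik).mul_bdd (c := c)
      (f := fun p : ℝ × ℝ => m₁ (p.2 - y) * k₁ (p.1 - p.2)) (g := fun p => v₁ p.1) ?_ ?_
    · exact ((hv.measurable.indicator measurableSet_Icc).comp measurable_fst).aestronglyMeasurable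
    · exact .of_forall fun p => vb _
  have key := integral_integral_swap hΦ
  have hL : rightConv m (rightConv k v b) b y = ∫ s, ∫ r, (m₁ (s - y) * k₁ (r - s)) * v₁ r := by
    rw [rightConv, intervalIntegral.integral_of_le hyb, ← integral_indicator measurableSet_Ioc]
    congr 1; ext s
    by_cases hs : s ∈ Ioc y b
    · have hs1 : s - y ∈ Ioc 0 T := ⟨by linarith [hs.1], by linarith [hs.2]⟩
      rw [indicator_of_mem hs, rightConv, intervalIntegral.integral_of_le hs.2,
        ← integral_indicator measurableSet_Ioc, ← integral_const_mul]
      congr 1; ext r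
      by_cases hr : r ∈ Ioc s b
      · have h1 : r - s ∈ Ioc 0 T := ⟨by linarith [hr.1], by linarith [hr.2, hs.1]⟩
        have h2 : r ∈ Icc y b := ⟨by linarith [hr.1, hs.1], hr.2⟩
        simp only [hm₁, hk₁, hv₁, indicator_of_mem hr, indicator_of_mem hs1, indicator_of_mem h1,
          indicator_of_mem h2, mul_assoc]
      · rw [indicator_of_notMem hr]
        by_cases h1 : r - s ∈ Ioc 0 T
        · have h2 : r ∉ Icc y b := fun h => hr ⟨by linarith [h1.1], h.2⟩
          simp [hv₁, indicator_of_notMem h2]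
        · simp [hk₁, indicator_of_notMem h1]
    · have hs1 : s - y ∉ Ioc 0 T := fun h => hs ⟨by linarith [h.1], by linarith [h.2]⟩
      simp [hm₁, indicator_of_notMem hs1, indicator_of_notMem hs]
  have hR : rightConv (fun t => ∫ q in 0..t, m q * k (t - q)) v b y
      = ∫ r, ∫ s, (m₁ (s - y) * k₁ (r - s)) * v₁ r := by
    rw [rightConv, intervalIntegral.integral_of_le hyb, ← integral_indicator measurableSet_Ioc]
    congr 1; ext r
    rw [integral_mul_const]
    by_cases hr : r ∈ Ioc y b
    · have hr' : r ∈ Icc y b := ⟨hr.1.le, hr.2⟩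
      rw [indicator_of_mem hr]
      simp only [hv₁, indicator_of_mem hr']
      congr 1
      have := intervalIntegral.integral_comp_sub_right (a := y) (b := r)
        (fun q => m q * k (r - y - q)) y
      rw [sub_self] at this
      rw [← this, intervalIntegral.integral_of_le hr.1.le, integral_Ioc_eq_integral_Ioo,
        ← integral_indicator measurableSet_Ioo]
      congr 1; ext s
      by_cases hs : s ∈ Ioo y r
      · have h1 : s - y ∈ Ioc 0 T := ⟨by linarith [hs.1], by linarith [hs.2, hr.2]⟩
        have h2 : r - s ∈ Ioc 0 T := ⟨by linarith [hs.2], by linarith [hs.1, hr.2]⟩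
        simp only [hm₁, hk₁, indicator_of_mem hs, indicator_of_mem h1, indicator_of_mem h2]
        congr 2; ring
      · rw [indicator_of_notMem hs]
        by_cases h1 : s - y ∈ Ioc 0 T
        · have h2 : r - s ∉ Ioc 0 T := fun h => hs ⟨by linarith [h1.1], by linarith [h.1]⟩
          simp [hk₁, indicator_of_notMem h2]
        · simp [hm₁, indicator_of_notMem h1]
    · rw [indicator_of_notMem hr]
      by_cases hr' : r ∈ Icc y b
      · obtain rfl : r = y := le_antisymm (not_lt.1 fun h => hr ⟨h, hr'.2⟩) hr'.1
        rw [integral_eq_zero_of_ae, zero_mul]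
        refine .of_forall fun s => ?_
        by_cases h1 : s - r ∈ Ioc 0 T
        · have h2 : r - s ∉ Ioc 0 T := fun h => by linarith [h1.1, h.1]
          simp [hk₁, indicator_of_notMem h2]
        · simp [hm₁, indicator_of_notMem h1]
      · simp [hv₁, indicator_of_notMem hr']
  rw [hL, hR, key]

lemma continuousOn_rightConv {k f : ℝ → ℝ} (hk : ∀ T, IntegrableOn k (Ioc 0 T))
    (hf : Continuous f) (b : ℝ) : ContinuousOn (rightConv k f b) (Iic b) := by
  intro y₀ hy₀
  set T := b - y₀ + 1 with hT
  set k₁ : ℝ → ℝ := (Ioc 0 T).indicator k with hk₁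
  have ik : Integrable k₁ := (integrable_indicator_iff measurableSet_Ioc).2 (hk T)
  obtain ⟨c, hc⟩ := (isCompact_Icc (a := y₀ - 1) (b := b)).exists_bound_of_continuousOn
    hf.continuousOn
  have hc0 : 0 ≤ c := (norm_nonneg _).trans (hc b (right_mem_Icc.2 (by linarith [mem_Iic.1 hy₀])))
  have hev : ∀ᶠ y in 𝓝[Iic b] y₀, y₀ - 1 < y ∧ y ≤ b := by
    filter_upwards [nhdsWithin_le_nhds (Ioi_mem_nhds (sub_one_lt y₀)), self_mem_nhdsWithin]
      with y h1 h2 using ⟨h1, h2⟩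
  have heq : ∀ y, y₀ - 1 < y ∧ y ≤ b →
      rightConv k f b y = ∫ t, (Iic (b - y)).indicator (fun t => k₁ t * f (y + t)) t := by
    rintro y ⟨h1, h2⟩
    have := intervalIntegral.integral_comp_sub_right (a := y) (b := b)
      (fun t => k t * f (y + t)) y
    simp only [add_sub_cancel, sub_self] at this
    rw [rightConv, this, intervalIntegral.integral_of_le (by linarith),
      ← integral_indicator measurableSet_Ioc]
    congr 1; ext t
    by_cases ht : t ∈ Ioc 0 (b - y)
    · have h3 : t ∈ Ioc 0 T := ⟨ht.1, by linarith [ht.2]⟩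
      rw [indicator_of_mem ht, indicator_of_mem (show t ∈ Iic (b - y) from ht.2)]
      simp only [hk₁, indicator_of_mem h3]
    · rw [indicator_of_notMem ht]
      by_cases h3 : t ∈ Iic (b - y)
      · have h4 : t ∉ Ioc 0 T := fun h => ht ⟨h.1, h3⟩
        rw [indicator_of_mem h3]
        simp [hk₁, indicator_of_notMem h4]
      · rw [indicator_of_notMem h3]
  have hcont : ContinuousWithinAt
      (fun y => ∫ t, (Iic (b - y)).indicator (fun t => k₁ t * f (y + t)) t) (Iic b) y₀ := by
    refine continuousWithinAt_of_dominated (bound := fun t => ‖k₁ t‖ * c) ?_ ?_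
      (ik.norm.mul_const c) ?_
    · refine .of_forall fun y => ?_
      exact (ik.aestronglyMeasurable.mul
        (hf.comp (by fun_prop)).aestronglyMeasurable).indicator measurableSet_Iic
    · filter_upwards [hev] with y hy
      refine .of_forall fun t => ?_
      by_cases h3 : t ∈ Iic (b - y)
      · rw [indicator_of_mem h3, norm_mul]
        by_cases h4 : t ∈ Ioc 0 T
        · exact mul_le_mul_of_nonneg_left
            (hc _ ⟨by linarith [h4.1, hy.1], by linarith [mem_Iic.1 h3]⟩) (norm_nonneg _)
        · simp [hk₁, indicator_of_notMem h4]
      · rw [indicator_of_notMem h3, norm_zero]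
        positivity
    · filter_upwards [compl_mem_ae_iff.2 (measure_singleton (μ := volume) (b - y₀))] with t ht
      rcases lt_or_gt_of_ne (show t ≠ b - y₀ from ht) with h | h
      · have hc1 : ContinuousWithinAt (fun y => k₁ t * f (y + t)) (Iic b) y₀ := by fun_prop
        refine hc1.congr_of_eventuallyEq ?_ ?_
        · filter_upwards [nhdsWithin_le_nhds (Iio_mem_nhds (show y₀ < b - t by linarith))] with y hy
          exact indicator_of_mem (show t ∈ Iic (b - y) by
            rw [mem_Iic]; linarith [mem_Iio.1 hy]) _
        · exact indicator_of_mem (show t ∈ Iic (b - y₀) from h.le) _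
      · refine (continuousWithinAt_const (b := (0 : ℝ))).congr_of_eventuallyEq ?_ ?_
        · filter_upwards [nhdsWithin_le_nhds (Ioi_mem_nhds (show b - t < y₀ by linarith))] with y hy
          exact indicator_of_notMem (fun h' => by
            linarith [mem_Iic.1 h', mem_Ioi.1 hy]) _
        · exact indicator_of_notMem (fun h' => by linarith [mem_Iic.1 h']) _
  refine hcont.congr_of_eventuallyEq (hev.mono heq) (heq y₀ ⟨by linarith, hy₀⟩)

lemma rightConv_one (f : ℝ → ℝ) (b y : ℝ) :
    rightConv (fun _ => 1) f b y = ∫ s in y..b, f s := by simp [rightConv]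

lemma integrableOn_one (T : ℝ) : IntegrableOn (fun _ : ℝ => (1 : ℝ)) (Ioc 0 T) := by
  simp [integrableOn_const_iff]

lemma integral_rightConv {k f : ℝ → ℝ} {b y : ℝ} (hk : ∀ T, IntegrableOn k (Ioc 0 T))
    (hf : Continuous f) (hyb : y ≤ b) :
    ∫ s in y..b, rightConv k f b s = rightConv (fun t => ∫ q in 0..t, k q) f b y := by
  rw [← rightConv_one, rightConv_rightConv integrableOn_one hk hf hyb]
  congr 1; ext t
  simp [intervalIntegral.integral_comp_sub_left]

lemma hasDerivAt_integral_left_of_continuousOn {F : ℝ → ℝ} {b y : ℝ}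
    (hF : ContinuousOn F (Iic b)) (hyb : y < b) :
    HasDerivAt (fun z => ∫ s in z..b, F s) (-F y) y := by
  refine intervalIntegral.integral_hasDerivAt_left ?_ ?_ (hF.continuousAt (Iic_mem_nhds hyb))
  · exact (hF.mono (by rw [uIcc_of_le hyb.le]; exact Icc_subset_Iic_self)).intervalIntegrable
  · exact (hF.mono Iio_subset_Iic_self).stronglyMeasurableAtFilter isOpen_Iio y hyb

lemma hasDerivAt_rightConv_integral {k f : ℝ → ℝ} {b y : ℝ} (hk : ∀ T, IntegrableOn k (Ioc 0 T))
    (hf : Continuous f) (hyb : y < b) :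
    HasDerivAt (rightConv (fun t => ∫ q in 0..t, k q) f b) (-rightConv k f b y) y := by
  refine (hasDerivAt_integral_left_of_continuousOn
    (continuousOn_rightConv hk hf b) hyb).congr_of_eventuallyEq ?_
  filter_upwards [Iio_mem_nhds hyb] with z hz using (integral_rightConv hk hf (le_of_lt hz)).symm

lemma integrableOn_log (T : ℝ) : IntegrableOn Real.log (Ioc 0 T) :=
  (intervalIntegral.intervalIntegrable_log' (a := 0) (b := T)).1

lemma integrableOn_const_add_log (C T : ℝ) :
    IntegrableOn (fun t => C + Real.log t) (Ioc 0 T) :=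
  (intervalIntegrable_const.add (intervalIntegral.intervalIntegrable_log' (a := 0) (b := T))).1

lemma integrableOn_rpow_sub_one {α : ℝ} (hα : 0 < α) (T : ℝ) :
    IntegrableOn (fun t : ℝ => t ^ (α - 1)) (Ioc 0 T) :=
  (intervalIntegral.intervalIntegrable_rpow' (by linarith)).1

lemma integrableOn_log_mul_rpow {α : ℝ} (hα : 0 < α) (T : ℝ) :
    IntegrableOn (fun t : ℝ => Real.log t * t ^ (α - 1)) (Ioc 0 T) := by
  rcases le_or_gt T 0 with hT | hT
  · simp [Ioc_eq_empty_of_le hT]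
  have h0 : IntegrableOn (fun t : ℝ => Real.log t * t ^ (α - 1)) (Ioc 0 1) := by
    refine Integrable.mono' (g := fun t => 2 / α * t ^ (α / 2 - 1))
      ((integrableOn_rpow_sub_one (half_pos hα) 1).const_mul _)
      (by fun_prop) ?_
    refine (ae_restrict_iff' measurableSet_Ioc).2 (.of_forall fun t ht => ?_)
    have h1 := Real.abs_log_mul_self_rpow_lt t (α / 2) ht.1 ht.2 (half_pos hα)
    have h2 : t ^ (α - 1) = t ^ (α / 2) * t ^ (α / 2 - 1) := by
      rw [← Real.rpow_add ht.1]; ring_nf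
    rw [h2, ← mul_assoc, norm_mul, Real.norm_eq_abs, Real.norm_eq_abs,
      abs_of_nonneg (Real.rpow_nonneg ht.1.le (α / 2 - 1))]
    refine mul_le_mul_of_nonneg_right (h1.le.trans_eq ?_) (Real.rpow_nonneg ht.1.le _)
    field_simp
  have h1 : IntegrableOn (fun t : ℝ => Real.log t * t ^ (α - 1)) (Icc 1 T) := by
    refine ContinuousOn.integrableOn_Icc fun t ht => ContinuousAt.continuousWithinAt ?_
    have : t ≠ 0 := by linarith [ht.1]
    exact (Real.continuousAt_log this).mul (Real.continuousAt_rpow_const _ _ (.inl this))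
  refine (h0.union h1).mono_set fun t ht => ?_
  rcases le_or_gt t 1 with h | h
  · exact .inl ⟨ht.1, h⟩
  · exact .inr ⟨h.le, ht.2⟩

lemma intervalIntegrable_log_mul_one_sub_rpow {α : ℝ} (hα : 0 < α) :
    IntervalIntegrable (fun v : ℝ => Real.log v * (1 - v) ^ (α - 1)) volume 0 1 := by
  refine IntervalIntegrable.trans (b := 1 / 2) ?_ ?_
  · refine intervalIntegral.intervalIntegrable_log'.mul_continuousOn fun v hv => ?_
    rw [uIcc_of_le (by norm_num)] at hv
    have : 1 - v ≠ 0 := by linarith [hv.2]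
    exact ((Real.continuousAt_rpow_const _ _ (.inl this)).comp (f := fun v => 1 - v)
      (by fun_prop)).continuousWithinAt
  · have h : IntervalIntegrable (fun v : ℝ => (1 - v) ^ (α - 1)) volume (1 / 2) 1 := by
      have := (intervalIntegral.intervalIntegrable_rpow' (a := 1 / 2) (b := 0) (r := α - 1)
        (by linarith)).comp_sub_left 1
      norm_num at this
      exact this
    refine h.continuousOn_mul fun v hv => ?_
    rw [uIcc_of_le (by norm_num)] at hv
    exact (Real.continuousAt_log (by linarith [hv.1])).continuousWithinAt

/-- Up to a suitable additive constant in the logarithm, `log t * t ^ (α - 1)` integrates to the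
convolution of the logarithm with `t ^ (α - 1)`. -/
lemma exists_integral_log_mul_rpow_eq {α : ℝ} (hα : 0 < α) :
    ∃ C : ℝ, ∀ t : ℝ, 0 ≤ t → ∫ r in 0..t, Real.log r * r ^ (α - 1) =
      ∫ q in 0..t, (C + Real.log q) * (t - q) ^ (α - 1) := by
  set c₁ := ∫ v in (0 : ℝ)..1, Real.log v * v ^ (α - 1) with hc₁
  set c₂ := ∫ v in (0 : ℝ)..1, Real.log v * (1 - v) ^ (α - 1) with hc₂
  have i₁ : ∫ v in (0 : ℝ)..1, v ^ (α - 1) = 1 / α := by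
    rw [integral_rpow (.inl (by linarith))]
    simp [Real.zero_rpow hα.ne']
  have hα' : -1 < α - 1 := by linarith
  have j₁ : IntervalIntegrable (fun v : ℝ => v ^ (α - 1)) volume 0 1 :=
    intervalIntegral.intervalIntegrable_rpow' hα'
  have i₂ : ∫ v in (0 : ℝ)..1, (1 - v) ^ (α - 1) = 1 / α := by
    rw [intervalIntegral.integral_comp_sub_left (fun v => v ^ (α - 1)) 1]
    simpa using i₁
  have j₂ : IntervalIntegrable (fun v : ℝ => (1 - v) ^ (α - 1)) volume 0 1 := by
    simpa using (j₁.comp_sub_left 1).symm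
  have j₃ : IntervalIntegrable (fun v : ℝ => Real.log v * v ^ (α - 1)) volume 0 1 :=
    (intervalIntegrable_iff_integrableOn_Ioc_of_le zero_le_one).2 (integrableOn_log_mul_rpow hα 1)
  have j₄ := intervalIntegrable_log_mul_one_sub_rpow hα
  refine ⟨α * (c₁ - c₂), fun t ht => ?_⟩
  rcases ht.eq_or_lt with rfl | ht
  · simp
  have e₁ := intervalIntegral.mul_integral_comp_mul_left (a := 0) (b := 1)
    (f := fun r => Real.log r * r ^ (α - 1)) t
  have e₂ := intervalIntegral.mul_integral_comp_mul_left (a := 0) (b := 1)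
    (f := fun q => (α * (c₁ - c₂) + Real.log q) * (t - q) ^ (α - 1)) t
  rw [mul_zero, mul_one] at e₁ e₂
  rw [← e₁, ← e₂]
  congr 1
  have f₁ : ∫ v in (0 : ℝ)..1, Real.log (t * v) * (t * v) ^ (α - 1) =
      ∫ v in (0 : ℝ)..1, (t ^ (α - 1) * Real.log t) * v ^ (α - 1) +
        t ^ (α - 1) * (Real.log v * v ^ (α - 1)) := by
    refine intervalIntegral.integral_congr_ae (.of_forall fun v hv => ?_)
    rw [uIoc_of_le zero_le_one] at hv
    rw [Real.log_mul ht.ne' hv.1.ne', Real.mul_rpow ht.le hv.1.le]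
    ring
  have f₂ : ∫ v in (0 : ℝ)..1, (α * (c₁ - c₂) + Real.log (t * v)) * (t - t * v) ^ (α - 1) =
      ∫ v in (0 : ℝ)..1, (t ^ (α - 1) * (α * (c₁ - c₂) + Real.log t)) * (1 - v) ^ (α - 1) +
        t ^ (α - 1) * (Real.log v * (1 - v) ^ (α - 1)) := by
    refine intervalIntegral.integral_congr_ae (.of_forall fun v hv => ?_)
    rw [uIoc_of_le zero_le_one] at hv
    rw [Real.log_mul ht.ne' hv.1.ne', show t - t * v = t * (1 - v) by ring,
      Real.mul_rpow ht.le (by linarith [hv.2])]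
    ring
  rw [f₁, f₂, intervalIntegral.integral_add (j₁.const_mul _) (j₃.const_mul _),
    intervalIntegral.integral_add (j₂.const_mul _) (j₄.const_mul _)]
  simp only [intervalIntegral.integral_const_mul, i₁, i₂, ← hc₁, ← hc₂]
  field_simp
  ring

lemma differentiableAt_rightConv_log {g : ℝ → ℝ} {c y₀ : ℝ} (hg : Continuous g)
    (hd : DifferentiableAt ℝ g y₀) (hc : y₀ < c) :
    DifferentiableAt ℝ (rightConv Real.log g c) y₀ := by
  set q := dslope g y₀ with hq
  have hqc : Continuous q := by
    rw [← continuousOn_univ] at hg ⊢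
    exact (continuousOn_dslope univ_mem).2 ⟨hg, hd⟩
  have hn : (fun t : ℝ => t * Real.log t) = fun t => ∫ r in 0..t, (1 + Real.log r) := by
    ext t
    rw [intervalIntegral.integral_add intervalIntegrable_const
      intervalIntegral.intervalIntegrable_log', integral_log]
    simp
  have hL : ∀ y, ∫ s in y..c, Real.log (s - y) = (c - y) * Real.log (c - y) - (c - y) := by
    intro y
    rw [intervalIntegral.integral_comp_sub_right (fun t => Real.log t), integral_log]
    simp
  have heq : rightConv Real.log g c =ᶠ[𝓝 y₀] fun y =>
      g y₀ * ((c - y) * Real.log (c - y) - (c - y)) +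
        (rightConv (fun t => t * Real.log t) q c y + (y - y₀) * rightConv Real.log q c y) := by
    filter_upwards [Iio_mem_nhds hc] with y hy
    have hy : y ≤ c := le_of_lt hy
    rw [← hL, rightConv, rightConv, rightConv, ← intervalIntegral.integral_const_mul,
      ← intervalIntegral.integral_const_mul, ← intervalIntegral.integral_add,
      ← intervalIntegral.integral_add]
    · refine intervalIntegral.integral_congr fun s _ => ?_
      have h := sub_smul_dslope g y₀ s
      rw [smul_eq_mul, ← hq] at h
      have h : g s = g y₀ + (s - y₀) * q s := by linarith
      simp only [h]
      ring
    · simpa using (intervalIntegrable_rightConv_integrand (f := fun _ => 1) integrableOn_log hy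
        continuousOn_const).const_mul (g y₀)
    · exact (intervalIntegrable_rightConv_integrand
        (fun T => (Real.continuous_mul_log.integrableOn_Icc).mono_set Ioc_subset_Icc_self) hy
        hqc.continuousOn).add
        ((intervalIntegrable_rightConv_integrand integrableOn_log hy hqc.continuousOn).const_mul _)
    · exact intervalIntegrable_rightConv_integrand
        (fun T => (Real.continuous_mul_log.integrableOn_Icc).mono_set Ioc_subset_Icc_self) hy
        hqc.continuousOn
    · exact (intervalIntegrable_rightConv_integrand integrableOn_log hy
        hqc.continuousOn).const_mul _
  refine DifferentiableAt.congr_of_eventuallyEq ?_ heq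
  have d₁ : DifferentiableAt ℝ (fun y => Real.log (c - y)) y₀ :=
    DifferentiableAt.log (by fun_prop) (by linarith)
  have d₂ : DifferentiableAt ℝ (rightConv (fun t => t * Real.log t) q c) y₀ := by
    rw [hn]
    exact (hasDerivAt_rightConv_integral (integrableOn_const_add_log 1) hqc hc).differentiableAt
  have d₃ : DifferentiableAt ℝ (fun y => (y - y₀) * rightConv Real.log q c y) y₀ := by
    have hcont : ContinuousAt (rightConv Real.log q c) y₀ :=
      (continuousOn_rightConv integrableOn_log hqc c).continuousAt (Iic_mem_nhds hc)
    suffices h : HasDerivAt (fun y => (y - y₀) * rightConv Real.log q c y)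
      (rightConv Real.log q c y₀) y₀ from h.differentiableAt
    refine hasDerivAt_iff_tendsto_slope.2 ?_
    refine (hcont.tendsto.mono_left nhdsWithin_le_nhds).congr' ?_
    filter_upwards [self_mem_nhdsWithin] with y hy
    have : y - y₀ ≠ 0 := sub_ne_zero.2 hy
    simp [slope_def_field]
    field_simp
  fun_prop

lemma hasDerivAt_integral_comp_sub {φ φ' J : ℝ → ℝ} {b c y : ℝ}
    (hφ : ∀ t, 0 < t → HasDerivAt φ (φ' t) t) (hφ' : ContinuousOn φ' (Ioi 0))
    (hJ : ContinuousOn J (Icc c b)) (hyc : y < c) (hcb : c ≤ b) :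
    HasDerivAt (fun z => ∫ s in c..b, φ (s - z) * J s) (∫ s in c..b, -φ' (s - y) * J s) y := by
  set ε := (c - y) / 2 with hε
  have hε0 : 0 < ε := by rw [hε]; linarith
  have hφc : ContinuousOn φ (Ioi 0) := fun t ht => (hφ t ht).continuousAt.continuousWithinAt
  have hpos : ∀ z < c, MapsTo (fun s => s - z) (Icc c b) (Ioi 0) := fun z hz s hs => by
    simp only [mem_Ioi]; linarith [hs.1]
  obtain ⟨B, hB⟩ := (isCompact_Icc (a := ε) (b := b - y + ε)).exists_bound_of_continuousOn
    (hφ'.mono fun t ht => mem_Ioi.2 (hε0.trans_le ht.1))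
  have hcts : ∀ z < c, ContinuousOn (fun s => φ (s - z) * J s) (Icc c b) := fun z hz =>
    (hφc.comp (by fun_prop) (hpos z hz)).mul hJ
  have hcts' : ContinuousOn (fun s => -φ' (s - y) * J s) (Icc c b) :=
    (hφ'.comp (by fun_prop) (hpos y hyc)).neg.mul hJ
  rw [← uIcc_of_le hcb] at hJ hcts hcts'
  refine (intervalIntegral.hasDerivAt_integral_of_dominated_loc_of_deriv_le
    (F := fun z s => φ (s - z) * J s) (F' := fun z s => -φ' (s - z) * J s)
    (s := Ioo (y - ε) (y + ε)) (bound := fun s => B * ‖J s‖)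
    (Ioo_mem_nhds (by linarith) (by linarith)) ?_ (hcts y hyc).intervalIntegrable ?_ ?_ ?_ ?_).2
  · filter_upwards [Iio_mem_nhds hyc] with z hz
    exact (hcts z hz).intervalIntegrable.def'.aestronglyMeasurable
  · exact hcts'.intervalIntegrable.def'.aestronglyMeasurable
  · refine .of_forall fun s hs z hz => ?_
    rw [uIoc_of_le hcb] at hs
    rw [norm_mul, norm_neg]
    refine mul_le_mul_of_nonneg_right (hB _ ⟨?_, ?_⟩) (norm_nonneg _)
    · linarith [hs.1, hz.2]
    · linarith [hs.2, hz.1]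
  · exact (continuousOn_const.mul hJ.norm).intervalIntegrable
  · refine .of_forall fun s hs z hz => ?_
    rw [uIoc_of_le hcb] at hs
    have h1 := (hφ (s - z) (by linarith [hs.1, hz.2])).comp z ((hasDerivAt_id z).const_sub s)
    simpa using h1.mul_const (J s)

/-- If the fractional integral of order `α` of a continuous function is differentiable on an
interval with continuous derivative `g`, then its order derivative is differentiable wherever `g`
is. -/
lemma differentiableAt_rightConv_log_mul_rpow {α : ℝ} (hα : 0 < α) {v g : ℝ → ℝ}
    {b c y₀ y₁ : ℝ} (hv : Continuous v) (hy₁ : y₁ < y₀) (hc : y₀ < c) (hcb : c < b)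
    (hJ : ∀ y ∈ Icc y₁ c, HasDerivAt (rightConv (fun t => t ^ (α - 1)) v b) (g y) y)
    (hg : ContinuousOn g (Icc y₁ c)) (hd : DifferentiableAt ℝ g y₀) :
    DifferentiableAt ℝ (rightConv (fun t => Real.log t * t ^ (α - 1)) v b) y₀ := by
  set J := rightConv (fun t : ℝ => t ^ (α - 1)) v b with hJdef
  set P := rightConv (fun t : ℝ => Real.log t * t ^ (α - 1)) v b with hPdef
  have hJc : ContinuousOn J (Iic b) := continuousOn_rightConv (integrableOn_rpow_sub_one hα) hv b
  have hPc : ContinuousOn P (Iic b) := continuousOn_rightConv (integrableOn_log_mul_rpow hα) hv b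
  have hy₁c : y₁ ≤ c := by linarith
  obtain ⟨C, hC⟩ := exists_integral_log_mul_rpow_eq hα
  set g' := IccExtend hy₁c ((Icc y₁ c).domRestrict g) with hg'
  have hg'c : Continuous g' := (continuousOn_iff_continuous_domRestrict.1 hg).Icc_extend'
  have hg'eq : ∀ y ∈ Icc y₁ c, g' y = g y := fun y hy => IccExtend_of_mem _ _ hy
  have hg'd : DifferentiableAt ℝ g' y₀ := hd.congr_of_eventuallyEq <| by
    filter_upwards [Icc_mem_nhds hy₁ hc] with y hy using hg'eq y hy
  set Q := rightConv Real.log g' c with hQdef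
  have hQc : ContinuousOn Q (Iic c) := continuousOn_rightConv integrableOn_log hg'c c
  have hJint : ∀ s ∈ Icc y₁ c, J s = J c - ∫ r in s..c, g' r := by
    intro s hs
    have hsub : uIcc s c ⊆ Icc y₁ c := by
      rw [uIcc_of_le hs.2]; exact Icc_subset_Icc_left hs.1
    rw [intervalIntegral.integral_eq_sub_of_hasDerivAt (f := J)
      (fun r hr => by rw [hg'eq r (hsub hr)]; exact hJ r (hsub hr))
      (hg'c.intervalIntegrable _ _)]
    ring
  have hL : ∀ z, ∫ s in z..c, Real.log (s - z) = (c - z) * Real.log (c - z) - (c - z) := by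
    intro z
    rw [intervalIntegral.integral_comp_sub_right (fun t => Real.log t), integral_log]
    simp
  have hG : ∀ z ∈ Ioo y₁ c, ∫ s in z..b, P s = C * (∫ s in z..b, J s) +
      (J c * ((c - z) * Real.log (c - z) - (c - z)) - ∫ s in z..c, Q s) +
        ∫ s in c..b, Real.log (s - z) * J s := by
    intro z hz
    have hzb : z ≤ b := (hz.2.trans hcb).le
    have hJzb : ContinuousOn J (Icc z b) := hJc.mono Icc_subset_Iic_self
    have hlogJ := intervalIntegrable_rightConv_integrand integrableOn_log hzb hJzb
    have e₁ : ∫ s in z..b, P s = rightConv (fun t => C + Real.log t) J b z := by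
      rw [hPdef, integral_rightConv (integrableOn_log_mul_rpow hα) hv hzb, hJdef,
        rightConv_rightConv (integrableOn_const_add_log C) (integrableOn_rpow_sub_one hα) hv hzb]
      refine intervalIntegral.integral_congr fun s hs => ?_
      rw [uIcc_of_le hzb] at hs
      simp only [hC (s - z) (by linarith [hs.1])]
    have e₂ : rightConv (fun t => C + Real.log t) J b z =
        C * (∫ s in z..b, J s) + ∫ s in z..b, Real.log (s - z) * J s := by
      rw [rightConv, ← intervalIntegral.integral_const_mul, ← intervalIntegral.integral_add]
      · simp only [add_mul]
      · exact ((hJzb.mono (uIcc_of_le hzb).subset).intervalIntegrable).const_mul _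
      · exact hlogJ
    have e₃ : (∫ s in z..c, Real.log (s - z) * J s) + ∫ s in c..b, Real.log (s - z) * J s =
        ∫ s in z..b, Real.log (s - z) * J s := by
      refine intervalIntegral.integral_add_adjacent_intervals
        (hlogJ.mono_set ?_) (hlogJ.mono_set ?_)
      · rw [uIcc_of_le hz.2.le, uIcc_of_le hzb]; exact Icc_subset_Icc_right hcb.le
      · rw [uIcc_of_le hcb.le, uIcc_of_le hzb]; exact Icc_subset_Icc_left hz.2.le
    have hg'i : ContinuousOn (rightConv (fun _ => 1) g' c) (Icc z c) :=
      (continuousOn_rightConv integrableOn_one hg'c c).mono Icc_subset_Iic_self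
    have e₄ : ∫ s in z..c, Real.log (s - z) * J s =
        J c * ((c - z) * Real.log (c - z) - (c - z)) -
          rightConv Real.log (rightConv (fun _ => 1) g' c) c z := by
      rw [← hL, rightConv, ← intervalIntegral.integral_const_mul, ← intervalIntegral.integral_sub]
      · refine intervalIntegral.integral_congr fun s hs => ?_
        rw [uIcc_of_le hz.2.le] at hs
        simp only [rightConv_one, hJint s ⟨hz.1.le.trans hs.1, hs.2⟩]
        ring
      · simpa using (intervalIntegrable_rightConv_integrand (f := fun _ => 1) integrableOn_log
          hz.2.le continuousOn_const).const_mul (J c)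
      · exact intervalIntegrable_rightConv_integrand integrableOn_log hz.2.le hg'i
    have e₅ : rightConv Real.log (rightConv (fun _ => 1) g' c) c z = ∫ s in z..c, Q s := by
      rw [rightConv_rightConv integrableOn_log integrableOn_one hg'c hz.2.le, hQdef,
        integral_rightConv integrableOn_log hg'c hz.2.le]
      simp
    rw [e₁, e₂, ← e₃, e₄, e₅]
    ring
  have hP : ∀ y ∈ Ioo y₁ c, P y = C * J y + J c * Real.log (c - y) - Q y -
      ∫ s in c..b, -(s - y)⁻¹ * J s := by
    intro y hy
    have hyb : y < b := hy.2.trans hcb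
    have d₀ := hasDerivAt_integral_left_of_continuousOn hPc hyb
    have d₁ := (hasDerivAt_integral_left_of_continuousOn hJc hyb).const_mul C
    have d₂ : HasDerivAt (fun z => J c * ((c - z) * Real.log (c - z) - (c - z)))
        (J c * -Real.log (c - y)) y := by
      have hne : c - y ≠ 0 := by linarith [hy.2]
      have h := ((Real.hasDerivAt_mul_log hne).sub (hasDerivAt_id _)).comp y
        ((hasDerivAt_id y).const_sub c)
      refine (h.const_mul (J c)).congr_deriv ?_
      ring
    have d₃ := hasDerivAt_integral_left_of_continuousOn hQc hy.2
    have d₄ := hasDerivAt_integral_comp_sub (φ := Real.log) (φ' := fun t => t⁻¹)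
      (fun t ht => Real.hasDerivAt_log ht.ne')
      (continuousOn_inv₀.mono fun t ht => ne_of_gt ht)
      (hJc.mono Icc_subset_Iic_self) hy.2 hcb.le
    have d₅ := ((d₁.add (d₂.sub d₃)).add d₄).congr_of_eventuallyEq
      (f₁ := fun z => ∫ s in z..b, P s) <| by
        filter_upwards [Ioo_mem_nhds hy.1 hy.2] with z hz using hG z hz
    linarith [d₀.unique d₅]
  refine DifferentiableAt.congr_of_eventuallyEq (f := fun y => C * J y + J c * Real.log (c - y) -
    Q y - ∫ s in c..b, -(s - y)⁻¹ * J s) ?_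
    (by filter_upwards [Ioo_mem_nhds hy₁ hc] with y hy using hP y hy)
  have t₁ : DifferentiableAt ℝ J y₀ := (hJ y₀ ⟨hy₁.le, hc.le⟩).differentiableAt
  have t₂ : DifferentiableAt ℝ (fun y => Real.log (c - y)) y₀ :=
    DifferentiableAt.log (by fun_prop) (by linarith)
  have t₃ : DifferentiableAt ℝ Q y₀ := differentiableAt_rightConv_log hg'c hg'd hc
  have t₄ : DifferentiableAt ℝ (fun y => ∫ s in c..b, -(s - y)⁻¹ * J s) y₀ := by
    refine (hasDerivAt_integral_comp_sub (φ := fun t => -t⁻¹) (φ' := fun t => (t ^ 2)⁻¹)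
      (fun t ht => ?_) (ContinuousOn.inv₀ (by fun_prop) fun t ht => ?_)
      (hJc.mono Icc_subset_Iic_self) hc hcb.le).differentiableAt
    · exact (hasDerivAt_inv ht.ne').neg.congr_deriv (neg_neg _)
    · exact pow_ne_zero _ (ne_of_gt ht)
  exact (((t₁.const_mul C).add (t₂.const_mul (J c))).sub t₃).sub t₄

lemma eq_of_hasDerivAt_of_eventuallyEq_right {f h : ℝ → ℝ} {f' h' x : ℝ} (hf : HasDerivAt f f' x)
    (hh : HasDerivAt h h' x) (heq : f =ᶠ[𝓝[>] x] h) : f' = h' := by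
  have hx : f x = h x := tendsto_nhds_unique_of_eventuallyEq
    (hf.continuousAt.tendsto.mono_left nhdsWithin_le_nhds)
    (hh.continuousAt.tendsto.mono_left nhdsWithin_le_nhds) heq
  exact (uniqueDiffWithinAt_Ioi x).eq_deriv _ hf.hasDerivWithinAt
    (hh.hasDerivWithinAt.congr_of_eventuallyEq heq hx)

/-- Differentiation under the integral sign with respect to the order. -/
lemma hasDerivAt_integral_rpow_order {u uσ : ℝ → ℝ → ℝ} {a b y σ₀ : ℝ}
    (hcont : ContinuousOn (fun p : ℝ × ℝ => u p.1 p.2) (Ioo 1 2 ×ˢ Icc a b))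
    (huσ : ∀ σ ∈ Ioo (1 : ℝ) 2, ∀ s ∈ Icc a b, HasDerivAt (fun τ => u τ s) (uσ σ s) σ)
    (hcontσ : ContinuousOn (fun p : ℝ × ℝ => uσ p.1 p.2) (Ioo 1 2 ×ˢ Icc a b))
    (hσ₀ : σ₀ ∈ Ioo (1 : ℝ) 2) (hy : y ∈ Icc a b) :
    HasDerivAt (fun τ => ∫ s in y..b, (s - y) ^ (1 - τ) * u τ s)
      ((∫ s in y..b, (s - y) ^ (1 - σ₀) * uσ σ₀ s) -
        ∫ s in y..b, Real.log (s - y) * (s - y) ^ (1 - σ₀) * u σ₀ s) σ₀ := by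
  obtain ⟨h1, h2⟩ := hσ₀
  set σ₁ := (σ₀ + 2) / 2 with hσ₁
  set σ₂ := (1 + σ₀) / 2 with hσ₂
  have hK : Icc σ₂ σ₁ ×ˢ Icc a b ⊆ Ioo 1 2 ×ˢ Icc a b :=
    prod_mono (fun τ hτ => ⟨by linarith [hτ.1], by linarith [hτ.2]⟩) Subset.rfl
  have hKc : IsCompact (Icc σ₂ σ₁ ×ˢ Icc a b) := isCompact_Icc.prod isCompact_Icc
  obtain ⟨B, hB⟩ := hKc.exists_bound_of_continuousOn (hcont.mono hK)
  obtain ⟨B', hB'⟩ := hKc.exists_bound_of_continuousOn (hcontσ.mono hK)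
  have hslice : ∀ {w : ℝ → ℝ → ℝ}, ContinuousOn (fun p : ℝ × ℝ => w p.1 p.2)
      (Ioo 1 2 ×ˢ Icc a b) → ∀ τ ∈ Ioo (1 : ℝ) 2, ContinuousOn (w τ) (Icc y b) := by
    intro w hw τ hτ
    exact hw.comp (f := fun s => (τ, s)) (by fun_prop) fun s hs => ⟨hτ, hy.1.trans hs.1, hs.2⟩
  have hpow : ∀ τ < (2 : ℝ), ∀ T, IntegrableOn (fun t : ℝ => t ^ (1 - τ)) (Ioc 0 T) := by
    intro τ hτ T
    have := integrableOn_rpow_sub_one (α := 2 - τ) (by linarith) T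
    rwa [show 2 - τ - 1 = 1 - τ by ring] at this
  have hlog : ∀ τ < (2 : ℝ), ∀ T,
      IntegrableOn (fun t : ℝ => Real.log t * t ^ (1 - τ)) (Ioc 0 T) := by
    intro τ hτ T
    have := integrableOn_log_mul_rpow (α := 2 - τ) (by linarith) T
    rwa [show 2 - τ - 1 = 1 - τ by ring] at this
  have i₁ := intervalIntegrable_rightConv_integrand (hpow σ₀ h2) hy.2
    (hslice hcontσ σ₀ ⟨h1, h2⟩)
  have i₂ := intervalIntegrable_rightConv_integrand (hlog σ₀ h2) hy.2 (hslice hcont σ₀ ⟨h1, h2⟩)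
  have hmem : Ioo σ₂ σ₁ ∈ 𝓝 σ₀ := Ioo_mem_nhds (by linarith) (by linarith)
  rw [← intervalIntegral.integral_sub i₁ i₂]
  refine (intervalIntegral.hasDerivAt_integral_of_dominated_loc_of_deriv_le
    (F := fun τ s => (s - y) ^ (1 - τ) * u τ s)
    (F' := fun τ s => (s - y) ^ (1 - τ) * uσ τ s - Real.log (s - y) * (s - y) ^ (1 - τ) * u τ s)
    (s := Ioo σ₂ σ₁)
    (bound := fun s => ((s - y) ^ (1 - σ₁) * B' + B') +
      (‖Real.log (s - y) * (s - y) ^ (1 - σ₁) * B‖ + ‖Real.log (s - y) * B‖))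
    hmem ?_ ?_ (i₁.sub i₂).def'.aestronglyMeasurable ?_ ?_ ?_).2
  · filter_upwards [hmem] with τ hτ
    exact (intervalIntegrable_rightConv_integrand (hpow τ (by linarith [hτ.2])) hy.2
      (hslice hcont τ ⟨by linarith [hτ.1], by linarith [hτ.2]⟩)).def'.aestronglyMeasurable
  · exact intervalIntegrable_rightConv_integrand (hpow σ₀ h2) hy.2 (hslice hcont σ₀ ⟨h1, h2⟩)
  · refine .of_forall fun s hs τ hτ => ?_
    rw [uIoc_of_le hy.2] at hs
    have ht : 0 < s - y := by linarith [hs.1]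
    have hp : (τ, s) ∈ Icc σ₂ σ₁ ×ˢ Icc a b := ⟨⟨hτ.1.le, hτ.2.le⟩, hy.1.trans hs.1.le, hs.2⟩
    have hu := hB _ hp
    have hu' := hB' _ hp
    have hB0 : 0 ≤ B := (norm_nonneg _).trans hu
    have hle : (s - y) ^ (1 - τ) ≤ (s - y) ^ (1 - σ₁) + 1 := by
      rcases le_or_gt (s - y) 1 with h | h
      · linarith [Real.rpow_le_rpow_of_exponent_ge ht h (show 1 - σ₁ ≤ 1 - τ by linarith [hτ.2])]
      · linarith [Real.rpow_le_one_of_one_le_of_nonpos h.le (show 1 - τ ≤ 0 by linarith [hτ.1]),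
          Real.rpow_nonneg ht.le (1 - σ₁)]
    have hn := Real.rpow_nonneg ht.le (1 - τ)
    have hn₁ := Real.rpow_nonneg ht.le (1 - σ₁)
    refine (norm_sub_le _ _).trans (add_le_add ?_ ?_)
    · rw [norm_mul, Real.norm_of_nonneg hn]
      calc _ ≤ ((s - y) ^ (1 - σ₁) + 1) * B' :=
            mul_le_mul hle hu' (norm_nonneg _) (by linarith)
        _ = _ := by ring
    · simp only [norm_mul, Real.norm_of_nonneg hn, Real.norm_of_nonneg hn₁, Real.norm_of_nonneg hB0]
      calc _ ≤ (‖Real.log (s - y)‖ * ((s - y) ^ (1 - σ₁) + 1)) * B := by gcongr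
        _ = _ := by ring
  · have j := intervalIntegrable_rightConv_integrand (f := fun _ => B)
      (hlog σ₁ (by linarith)) hy.2 continuousOn_const
    have j' := intervalIntegrable_rightConv_integrand (f := fun _ => B)
      integrableOn_log hy.2 continuousOn_const
    exact ((intervalIntegrable_rightConv_integrand (f := fun _ => B')
      (hpow σ₁ (by linarith)) hy.2 continuousOn_const).add intervalIntegrable_const).add
      (j.norm.add j'.norm)
  · refine .of_forall fun s hs τ hτ => ?_
    rw [uIoc_of_le hy.2] at hs
    have ht : 0 < s - y := by linarith [hs.1]
    have d := (((hasDerivAt_id τ).const_sub 1).const_rpow ht).mul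
      (huσ τ ⟨by linarith [hτ.1], by linarith [hτ.2]⟩ s ⟨hy.1.trans hs.1.le, hs.2⟩)
    refine d.congr_deriv ?_
    simp only [id]
    ring


/-- sensitivity formula (4.3) of the paper, case `n = 2`, right-sided.
With `J(σ,y) = ∫_y^b (s-y)^{1-σ} u(σ,s) ds`, first and second spatial partials `Jx`,
`Jxx`, partial `Jσ = ∂J/∂σ` and its spatial derivative `Jσx` (valid on a neighborhood
`V` of `(σ₀,x)`), commuting third-order mixed partials (common value `M`), and with
`D1`, `D2` the second derivatives at `x` of
`y ↦ ∫_y^b (s-y)^{1-σ₀} (∂u/∂σ)(σ₀,s) ds` and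
`y ↦ ∫_y^b log(s-y)(s-y)^{1-σ₀} u(σ₀,s) ds`, the map
`σ ↦ (1/Γ(2-σ)) Jxx(σ,x)` is differentiable at `σ₀` with derivative
`(1/Γ(2-σ₀)) D1 + A₂(σ₀)(1/Γ(2-σ₀)) Jxx(σ₀,x) - (1/Γ(2-σ₀)) D2`, where
`A₂(σ) = Γ(2-σ) (d/dσ)(1/Γ(2-σ))`. -/
theorem stmt5 (a b : ℝ) (hab : a < b) (x : ℝ) (hx : x ∈ Set.Ico a b)
    (u uσ : ℝ → ℝ → ℝ)
    (hcont : ContinuousOn (fun p : ℝ × ℝ => u p.1 p.2) (Set.Ioo 1 2 ×ˢ Set.Icc a b))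
    (huσ : ∀ σ ∈ Set.Ioo (1:ℝ) 2, ∀ s ∈ Set.Icc a b,
      HasDerivAt (fun τ => u τ s) (uσ σ s) σ)
    (hcontσ : ContinuousOn (fun p : ℝ × ℝ => uσ p.1 p.2) (Set.Ioo 1 2 ×ˢ Set.Icc a b))
    (σ₀ : ℝ) (hσ₀ : σ₀ ∈ Set.Ioo (1:ℝ) 2)
    (Jx Jxx Jσ Jσx : ℝ → ℝ → ℝ)
    (V : Set (ℝ × ℝ)) (hV : V ∈ nhds (σ₀, x))
    (hJx : ∀ p ∈ V,
      HasDerivAt (fun y => ∫ s in y..b, (s - y) ^ (1 - p.1) * u p.1 s) (Jx p.1 p.2) p.2)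
    (hJxx : ∀ p ∈ V, HasDerivAt (fun y => Jx p.1 y) (Jxx p.1 p.2) p.2)
    (hJσ : ∀ p ∈ V,
      HasDerivAt (fun τ => ∫ s in p.2..b, (s - p.2) ^ (1 - τ) * u τ s) (Jσ p.1 p.2) p.1)
    (hJσx : ∀ p ∈ V, HasDerivAt (fun y => Jσ p.1 y) (Jσx p.1 p.2) p.2)
    (M : ℝ)
    (hM1 : HasDerivAt (fun τ => Jxx τ x) M σ₀)
    (hM2 : HasDerivAt (fun y => Jσx σ₀ y) M x)
    (D1 D2 : ℝ)
    (hD1 : HasDerivAt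
      (deriv (fun y => ∫ s in y..b, (s - y) ^ (1 - σ₀) * uσ σ₀ s)) D1 x)
    (hD2 : HasDerivAt
      (deriv (fun y => ∫ s in y..b, Real.log (s - y) * (s - y) ^ (1 - σ₀) * u σ₀ s)) D2 x) :
    HasDerivAt (fun σ => (1 / Real.Gamma (2 - σ)) * Jxx σ x)
      ((1 / Real.Gamma (2 - σ₀)) * D1
        + (Real.Gamma (2 - σ₀) * deriv (fun τ => 1 / Real.Gamma (2 - τ)) σ₀)
            * ((1 / Real.Gamma (2 - σ₀)) * Jxx σ₀ x)
        - (1 / Real.Gamma (2 - σ₀)) * D2) σ₀ := by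
  have hσ := hσ₀
  obtain ⟨h1, h2⟩ := hσ₀
  set F₁ := fun y => ∫ s in y..b, (s - y) ^ (1 - σ₀) * uσ σ₀ s with hF₁
  set F₂ := fun y => ∫ s in y..b, Real.log (s - y) * (s - y) ^ (1 - σ₀) * u σ₀ s with hF₂
  have hslice : ContinuousOn (u σ₀) (Icc a b) :=
    hcont.comp (f := fun s => (σ₀, s)) (by fun_prop) fun s hs => ⟨hσ, hs⟩
  set v := IccExtend hab.le ((Icc a b).domRestrict (u σ₀)) with hvdef
  have hv : Continuous v := (continuousOn_iff_continuous_domRestrict.1 hslice).Icc_extend'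
  have hconv : ∀ k : ℝ → ℝ, ∀ z ∈ Icc a b,
      rightConv k v b z = ∫ s in z..b, k (s - z) * u σ₀ s := by
    intro k z hz
    refine intervalIntegral.integral_congr fun s hs => ?_
    rw [uIcc_of_le hz.2] at hs
    have : v s = u σ₀ s := IccExtend_of_mem _ _ ⟨hz.1.trans hs.1, hs.2⟩
    simp only [this]
  have hexp : 2 - σ₀ - 1 = 1 - σ₀ := by ring
  have hVx : ∀ᶠ y in 𝓝 x, (σ₀, y) ∈ V :=
    (Continuous.prodMk_right σ₀).continuousAt.eventually hV
  obtain ⟨δ, hδ, hδV⟩ := Metric.eventually_nhds_iff.1 hVx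
  set d := min (x + δ) b with hd
  have hxd : x < d := lt_min (by linarith) hx.2
  have hdb : d ≤ b := min_le_right _ _
  have hmemV : ∀ y ∈ Ioo x d, (σ₀, y) ∈ V := fun y hy => hδV <| by
    rw [Real.dist_eq, abs_of_pos (by linarith [hy.1])]
    linarith [hy.2.trans_le (min_le_left _ _)]
  have hab' : ∀ y ∈ Ioo x d, y ∈ Ioo a b := fun y hy =>
    ⟨hx.1.trans_lt hy.1, hy.2.trans_le hdb⟩
  have hderiv : ∀ y ∈ Ioo x d, deriv F₁ y - deriv F₂ y = Jσx σ₀ y := by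
    intro y hy
    have hF₂d : DifferentiableAt ℝ F₂ y := by
      have hsub : Icc ((x + y) / 2) ((y + d) / 2) ⊆ Ioo x d := fun z hz =>
        ⟨by linarith [hz.1, hy.1], by linarith [hz.2, hy.2]⟩
      have key := differentiableAt_rightConv_log_mul_rpow (α := 2 - σ₀) (v := v) (g := Jx σ₀)
        (b := b) (c := (y + d) / 2) (y₀ := y) (y₁ := (x + y) / 2) (by linarith) hv
        (by linarith [hy.1]) (by linarith [hy.2]) (by linarith [hy.2]) ?_ ?_ ?_
      · refine key.congr_of_eventuallyEq ?_
        filter_upwards [Ioo_mem_nhds (hab' y hy).1 (hab' y hy).2] with z hz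
        rw [hconv _ z ⟨hz.1.le, hz.2.le⟩, hexp]
      · intro z hz
        refine (hJx (σ₀, z) (hmemV z (hsub hz))).congr_of_eventuallyEq ?_
        have hz' := hab' z (hsub hz)
        filter_upwards [Ioo_mem_nhds hz'.1 hz'.2] with w hw
        rw [hconv _ w ⟨hw.1.le, hw.2.le⟩, hexp]
      · exact fun z hz =>
          (hJxx (σ₀, z) (hmemV z (hsub hz))).continuousAt.continuousWithinAt
      · exact (hJxx (σ₀, y) (hmemV y hy)).differentiableAt
    have heq : F₁ =ᶠ[𝓝 y] fun z => Jσ σ₀ z + F₂ z := by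
      filter_upwards [Ioo_mem_nhds hy.1 hy.2] with z hz
      have := (hJσ (σ₀, z) (hmemV z hz)).unique (hasDerivAt_integral_rpow_order hcont huσ hcontσ hσ
        (Ioo_subset_Icc_self (hab' z hz)))
      simp only at this
      simp only [hF₁, hF₂, this]
      ring
    have hd₁ := ((hJσx (σ₀, y) (hmemV y hy)).add hF₂d.hasDerivAt).congr_of_eventuallyEq heq
    rw [hd₁.deriv]
    ring
  have hM : D1 - D2 = M := by
    refine eq_of_hasDerivAt_of_eventuallyEq_right (hD1.sub hD2) hM2 ?_
    filter_upwards [Ioo_mem_nhdsGT hxd] with y hy using hderiv y hy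
  have hΓ : Real.Gamma (2 - σ₀) ≠ 0 := (Real.Gamma_pos_of_pos (by linarith)).ne'
  have hΓd : DifferentiableAt ℝ (fun τ => 1 / Real.Gamma (2 - τ)) σ₀ := by
    have hΓ' : DifferentiableAt ℝ Real.Gamma (2 - σ₀) :=
      Real.differentiableAt_Gamma fun m h => by
        have : (0 : ℝ) ≤ m := m.cast_nonneg
        linarith
    have hc : DifferentiableAt ℝ (fun τ => Real.Gamma (2 - τ)) σ₀ :=
      DifferentiableAt.comp (g := Real.Gamma) (f := fun τ => 2 - τ) σ₀ hΓ' (by fun_prop)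
    exact (differentiableAt_const 1).div hc hΓ
  refine (hΓd.hasDerivAt.mul hM1).congr_deriv ?_
  rw [← hM]
  field_simp
  ring
end
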